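/- Let c be real-valued on Γ, let J be any of the risk criteria J_ψ, Ĵ_ψ, R₁ (CVaR) or R₂ (VaR), and let Π_⋆ ∈ {Π, Π', Π_sm, Π'_sm, Π_ss, Π'_ss}. Then, with respect to J and Π_⋆, the optimal risk function g(x) = inf over π ∈ Π_⋆ of J(π, x) is lower semianalytic, and for each ε > 0 there exists an ε-optimal policy π* ∈ Π_⋆ that is moreover optimal for every state admitting an optimal policy. -/

import Mathlib

open MeasureTheory ProbabilityTheory Filter
open scoped ENNReal NNReal Topology

noncomputable section

namespace PaperStmt

/-- The Borel σ-algebra of the topology of weak convergence on the space of Borel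
probability measures. -/
instance instMeasProb {Ω : Type*} [MeasurableSpace Ω] [TopologicalSpace Ω]
    [OpensMeasurableSpace Ω] : MeasurableSpace (ProbabilityMeasure Ω) := borel _

/-- A set is universally measurable if it is measurable with respect to the completion of
every Borel probability measure. -/
def UniversallyMeasurableSet {α : Type*} [MeasurableSpace α] (s : Set α) : Prop :=
  ∀ μ : Measure α, IsProbabilityMeasure μ → NullMeasurableSet s μ

/-- A map between measurable spaces is universally measurable if preimages of measurable
sets are universally measurable. -/
def UniversallyMeasurable {α β : Type*} [MeasurableSpace α] [MeasurableSpace β]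
    (f : α → β) : Prop :=
  ∀ s : Set β, MeasurableSet s → UniversallyMeasurableSet (f ⁻¹' s)

/-- A function into the extended reals is lower semianalytic if all its sublevel sets are
analytic. -/
def LowerSemianalytic {γ : Type*} [TopologicalSpace γ] (f : γ → EReal) : Prop :=
  ∀ r : ℝ, MeasureTheory.AnalyticSet {x | f x ≤ (r : EReal)}

/-- Lower semianalyticity on a given (analytic) domain. -/
def LowerSemianalyticOn {γ : Type*} [TopologicalSpace γ] (D : Set γ) (f : γ → EReal) : Prop :=
  ∀ r : ℝ, MeasureTheory.AnalyticSet {x | x ∈ D ∧ f x ≤ (r : EReal)}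

/-- Upper semianalyticity on a given (analytic) domain. -/
def UpperSemianalyticOn {γ : Type*} [TopologicalSpace γ] (D : Set γ) (f : γ → EReal) : Prop :=
  ∀ r : ℝ, MeasureTheory.AnalyticSet {x | x ∈ D ∧ (r : EReal) ≤ f x}

/-- The nonnegative part of an extended real number, as an element of `ℝ≥0∞`. -/
def ePos (y : EReal) : ℝ≥0∞ := if y = ⊤ then ⊤ else ENNReal.ofReal y.toReal

/-- The integral `∫ f⁺ dμ - ∫ f⁻ dμ` of an extended-real-valued function, with the
convention `∞ - ∞ = ∞`. -/
def eint {γ : Type*} [MeasurableSpace γ] (μ : Measure γ) (f : γ → EReal) : EReal :=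
  if (∫⁻ x, ePos (f x) ∂μ) = ⊤ then ⊤
  else ((∫⁻ x, ePos (f x) ∂μ : ℝ≥0∞) : EReal) - ((∫⁻ x, ePos (-f x) ∂μ : ℝ≥0∞) : EReal)

/-- Finite sums of extended reals, with the convention `∞ - ∞ = ∞`. -/
def esum {n : ℕ} (v : Fin n → EReal) : EReal :=
  if (∑ i, ePos (v i)) = ⊤ then ⊤
  else ((∑ i, ePos (v i) : ℝ≥0∞) : EReal) - ((∑ i, ePos (-v i) : ℝ≥0∞) : EReal)

/-- The space `H_n = (𝕏 × 𝔸)ⁿ × 𝕏` of histories `h_n = (x_0,a_0,…,x_n)`. -/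
abbrev Hist (X A : Type*) (n : ℕ) := (Fin n → X × A) × X

/-- The sample space `Ω = (𝕏 × 𝔸)^∞`. -/
abbrev Traj (X A : Type*) := ℕ → X × A

/-- The initial state `x_0` of a history. -/
def firstState {X A : Type*} : ∀ {n : ℕ}, Hist X A n → X
  | 0, h => h.2
  | _ + 1, h => (h.1 0).1

/-- A universally measurable policy for the MDP with control constraint `Acts`. -/
structure Policy {X A : Type*} [MeasurableSpace X] [MeasurableSpace A]
    (Acts : X → Set A) where
  μ : ∀ n : ℕ, Hist X A n → Measure A
  isProb : ∀ n h, IsProbabilityMeasure (μ n h)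
  umeas : ∀ (n : ℕ) (B : Set A), MeasurableSet B →
    UniversallyMeasurable fun h : Hist X A n => μ n h B
  feasible : ∀ n h, μ n h (Acts h.2) = 1

namespace Policy

variable {X A : Type*} [MeasurableSpace X] [MeasurableSpace A] {Acts : X → Set A}

/-- Nonrandomized policies: every decision is a Dirac measure. -/
def Nonrandomized (π : Policy Acts) : Prop :=
  ∀ n h, ∃ a : A, π.μ n h = Measure.dirac a

/-- Markov policies: the decision depends only on the current state. -/
def Markov (π : Policy Acts) : Prop :=
  ∃ m : ℕ → X → Measure A, ∀ n h, π.μ n h = m n h.2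

/-- Stationary policies. -/
def Stationary (π : Policy Acts) : Prop :=
  ∃ m : X → Measure A, ∀ n h, π.μ n h = m h.2

/-- Semi-Markov policies: the decision depends only on `(x_0, x_n)`. -/
def SemiMarkov (π : Policy Acts) : Prop :=
  ∃ m : ℕ → X × X → Measure A, ∀ n h, π.μ n h = m n (firstState h, h.2)

/-- Semi-stationary policies. -/
def SemiStationary (π : Policy Acts) : Prop :=
  ∃ m : X × X → Measure A, ∀ n h, π.μ n h = m (firstState h, h.2)

end Policy

variable {X A : Type*} [MeasurableSpace X] [MeasurableSpace A]

/-- The iterated integral giving the finite-dimensional distributions of the process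
induced by an initial distribution, the transition kernel and a policy. -/
def histInt (p0 : Measure X) (q : Kernel (X × A) X)
    (ν : ∀ n : ℕ, Hist X A n → Measure A) :
    ∀ n : ℕ, (Hist X A n → ℝ≥0∞) → ℝ≥0∞
  | 0, f => ∫⁻ x, f (Fin.elim0, x) ∂p0
  | n + 1, f => histInt p0 q ν n fun h =>
      ∫⁻ a, ∫⁻ y, f (Fin.snoc h.1 (h.2, a), y) ∂(q (h.2, a)) ∂(ν n h)

/-- `Induces q π p0 p` says that `p` is (the restriction to the Borel σ-algebra of) the
strategic measure `ρ_{p0}[π]`, i.e. `p` has the finite-dimensional distributions generated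
by `p0`, the policy `π`, and the transition kernel `q`. -/
def Induces (q : Kernel (X × A) X) {Acts : X → Set A} (π : Policy Acts)
    (p0 : Measure X) (p : Measure (Traj X A)) : Prop :=
  ∀ (n : ℕ) (B : Set (Hist X A n)), MeasurableSet B →
    p {ω : Traj X A | ((fun i : Fin n => ω i.val), (ω n).1) ∈ B}
      = histInt p0 q π.μ n (B.indicator fun _ => 1)

/-- The set of strategic measures induced by policies in the class `C` (over all initial
distributions). -/
def SOf (q : Kernel (X × A) X) (Acts : X → Set A) (C : Policy Acts → Prop) :
    Set (ProbabilityMeasure (Traj X A)) :=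
  {p | ∃ (π : Policy Acts) (p0 : ProbabilityMeasure X),
    C π ∧ Induces q π p0.toMeasure p.toMeasure}

variable [TopologicalSpace X] [BorelSpace X] [TopologicalSpace A] [BorelSpace A]

/-- The section `tilde-S_⋆(x)`: strategic measures in the class with initial distribution `δ_x`. -/
def tsec (q : Kernel (X × A) X) (Acts : X → Set A) (C : Policy Acts → Prop) (x : X) :
    Set (ProbabilityMeasure (Traj X A)) :=
  {p | p ∈ SOf q Acts C ∧ p.toMeasure.map (fun ω => (ω 0).1) = Measure.dirac x}

/-- The set `tilde-S_⋆ ⊂ 𝕏 × P(Ω)`. -/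
def tset (q : Kernel (X × A) X) (Acts : X → Set A) (C : Policy Acts → Prop) :
    Set (X × ProbabilityMeasure (Traj X A)) :=
  {xp | xp.2 ∈ tsec q Acts C xp.1}

end PaperStmt

namespace PaperStmt

variable {X A : Type*} [MeasurableSpace X] [MeasurableSpace A]

/-- The partial sum `Σ_{k=0}^{n-1} c(x_{k+j}, a_{k+j})` along a sample path, with the
convention `∞ - ∞ = ∞`. -/
def pathSum (c : X × A → EReal) (n j : ℕ) (ω : Traj X A) : EReal :=
  esum fun k : Fin n => c (ω (k.val + j))

/-- Division by `n` in the extended reals. -/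
def avg (n : ℕ) (y : EReal) : EReal := (((n : ℝ)⁻¹ : ℝ) : EReal) * y

/-- The risk functional `J_ψ`: `limsup_n n⁻¹ ψ⁻¹(E[ψ(Σ_{k<n} c(x_k,a_k))])`. -/
def Jpsi (c : X × A → EReal) (ψ : EReal → ℝ≥0∞) (ψinv : ℝ≥0∞ → EReal)
    (p : ProbabilityMeasure (Traj X A)) : EReal :=
  limsup (fun n : ℕ => avg n (ψinv (∫⁻ ω, ψ (pathSum c n 0 ω) ∂p.toMeasure))) atTop

/-- The risk functional `Ĵ_ψ`: `limsup_n sup_{j≥0} n⁻¹ ψ⁻¹(E[ψ(Σ_{k<n} c(x_{j+k},a_{j+k}))])`. -/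
def JpsiHat (c : X × A → EReal) (ψ : EReal → ℝ≥0∞) (ψinv : ℝ≥0∞ → EReal)
    (p : ProbabilityMeasure (Traj X A)) : EReal :=
  limsup (fun n : ℕ => ⨆ j : ℕ, avg n (ψinv (∫⁻ ω, ψ (pathSum c n j ω) ∂p.toMeasure))) atTop

/-- The pathwise average cost `c̄(ω) = limsup_n n⁻¹ Σ_{k<n} c(x_k,a_k)`. -/
def cbar (c : X × A → EReal) (ω : Traj X A) : EReal :=
  limsup (fun n : ℕ => avg n (pathSum c n 0 ω)) atTop

/-- The `CVaR_α` functional of the pathwise average cost. -/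
def Rcvar (c : X × A → EReal) (α : ℝ) (p : ProbabilityMeasure (Traj X A)) : EReal :=
  ⨅ z : ℝ, ((z : EReal) +
    (((ENNReal.ofReal α)⁻¹ * ∫⁻ ω, ePos (cbar c ω - (z : EReal)) ∂p.toMeasure : ℝ≥0∞) : EReal))

/-- The `VaR_α` functional of the pathwise average cost. -/
def Rvar (c : X × A → EReal) (α : ℝ) (p : ProbabilityMeasure (Traj X A)) : EReal :=
  ⨅ (z : ℝ) (_ : 1 - ENNReal.ofReal α ≤ p.toMeasure {ω | cbar c ω ≤ (z : EReal)}), (z : EReal)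

end PaperStmt

namespace PaperStmt

variable {X A : Type*} [TopologicalSpace X] [PolishSpace X] [MeasurableSpace X] [BorelSpace X]
  [TopologicalSpace A] [PolishSpace A] [MeasurableSpace A] [BorelSpace A]

/-- The optimal value function `g(x) = inf_{π ∈ Π_⋆} J(π, x)`, expressed through strategic
measures with initial distribution `δ_x`. -/
def gOpt (q : Kernel (X × A) X) {Acts : X → Set A} (C : Policy Acts → Prop)
    (J : ProbabilityMeasure (Traj X A) → EReal) (x : X) : EReal :=
  ⨅ (π : Policy Acts) (_ : C π) (p : ProbabilityMeasure (Traj X A))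
    (_ : Induces q π (Measure.dirac x) p.toMeasure), J p

/-- Existence of a policy in the class `C` that is `ε`-optimal w.r.t. `J` and `C`, and
moreover optimal at every state that admits an optimal policy in `C`. -/
def GoodPolicy (q : Kernel (X × A) X) {Acts : X → Set A} (C : Policy Acts → Prop)
    (J : ProbabilityMeasure (Traj X A) → EReal) (ε : ℝ) : Prop :=
  ∃ (π : Policy Acts) (R : X → ProbabilityMeasure (Traj X A)),
    C π ∧ (∀ x, Induces q π (Measure.dirac x) (R x).toMeasure) ∧
    (∀ x, (gOpt q C J x ≠ ⊥ → J (R x) ≤ gOpt q C J x + (ε : EReal)) ∧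
          (gOpt q C J x = ⊥ → J (R x) ≤ ((-ε⁻¹ : ℝ) : EReal))) ∧
    (∀ x, (∃ (π' : Policy Acts) (p : ProbabilityMeasure (Traj X A)),
            C π' ∧ Induces q π' (Measure.dirac x) p.toMeasure ∧ J p = gOpt q C J x) →
          J (R x) = gOpt q C J x)

end PaperStmt

set_option linter.unusedSectionVars false

namespace PaperStmt

/-- Measurability with respect to the completion of every probability measure. -/
def UM {α β : Type*} [MeasurableSpace α] [MeasurableSpace β] (f : α → β) : Prop :=
  ∀ μ : Measure α, IsProbabilityMeasure μ → AEMeasurable f μ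

/-- The σ-algebra of universally measurable sets. -/
abbrev umSpace (α : Type*) [MeasurableSpace α] : MeasurableSpace α where
  MeasurableSet' s := UniversallyMeasurableSet s
  measurableSet_empty := fun _ _ => MeasurableSet.empty.nullMeasurableSet
  measurableSet_compl _ hs μ hμ := (hs μ hμ).compl
  measurableSet_iUnion _ hf μ hμ := NullMeasurableSet.iUnion fun i => hf i μ hμ

section UMBasics

variable {α β γ : Type*} [MeasurableSpace α] [MeasurableSpace β] [MeasurableSpace γ]

theorem UM.of_measurable {f : α → β} (hf : Measurable f) : UM f := fun _ _ => hf.aemeasurable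

theorem UM.universallyMeasurable {f : α → β} (hf : UM f) : UniversallyMeasurable f :=
  fun _ hs μ hμ => (hf μ hμ).nullMeasurable hs

theorem UniversallyMeasurable.um [MeasurableSpace.CountablyGenerated β] {f : α → β}
    (hf : UniversallyMeasurable f) : UM f :=
  fun μ hμ => NullMeasurable.aemeasurable fun _ hs => hf _ hs μ hμ

theorem UM.comp {g : β → γ} {f : α → β} (hg : UM g) (hf : UM f) : UM (fun x => g (f x)) := by
  intro μ hμ
  have hp : IsProbabilityMeasure (μ.map f) := Measure.isProbabilityMeasure_map (hf μ hμ)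
  exact (hg _ hp).comp_aemeasurable (hf μ hμ)

theorem UM.comp_measurable {g : β → γ} {f : α → β} (hg : UM g) (hf : Measurable f) :
    UM (fun x => g (f x)) := hg.comp (.of_measurable hf)

theorem _root_.Measurable.comp_um {g : β → γ} {f : α → β} (hg : Measurable g) (hf : UM f) :
    UM (fun x => g (f x)) := (UM.of_measurable hg).comp hf

theorem UM.prodMk {f : α → β} {g : α → γ} (hf : UM f) (hg : UM g) : UM (fun x => (f x, g x)) :=
  fun μ hμ => (hf μ hμ).prodMk (hg μ hμ)

theorem UM.aemeasurable_of_finite {f : α → β} (hf : UM f) (μ : Measure α) [IsFiniteMeasure μ] :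
    AEMeasurable f μ := by
  by_cases h0 : μ = 0
  · subst h0
    exact aemeasurable_zero_measure
  · have : NeZero μ := ⟨h0⟩
    have hp : IsProbabilityMeasure ((μ Set.univ)⁻¹ • μ) := inferInstance
    have h1 := hf _ hp
    refine h1.mono_ac ?_
    refine Measure.AbsolutelyContinuous.mk fun s _ hs => ?_
    simpa [measure_ne_top] using hs

theorem UniversallyMeasurableSet.preimage {f : α → β} {s : Set β}
    (hs : UniversallyMeasurableSet s) (hf : UM f) : UniversallyMeasurableSet (f ⁻¹' s) := by
  intro μ hμ
  have hp : IsProbabilityMeasure (μ.map f) := Measure.isProbabilityMeasure_map (hf μ hμ)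
  have h1 := hs _ hp
  obtain ⟨t, ht, hst⟩ := h1
  refine NullMeasurableSet.congr ((hf μ hμ).nullMeasurable ht) ?_
  have h2 : ∀ᵐ x ∂μ, s (f x) = t (f x) := ae_of_ae_map (hf μ hμ) hst
  exact EventuallyEq.symm (f := f ⁻¹' s) h2

theorem um_of_measurable_umSpace [MeasurableSpace.CountablyGenerated β] {f : α → β}
    (hf : @Measurable α β (umSpace α) _ f) : UM f :=
  UniversallyMeasurable.um fun _ hs => hf hs

theorem UM.ite {s : Set α} [DecidablePred (· ∈ s)] (hs : UniversallyMeasurableSet s) {f g : α → β} (hf : UM f)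
    (hg : UM g) : UM (fun x => if x ∈ s then f x else g x) := by
  classical
  intro μ hμ
  obtain ⟨t, ht, hst⟩ := hs μ hμ
  have h1 : AEMeasurable (fun x => if x ∈ t then f x else g x) μ := by
    refine ⟨fun x => if x ∈ t then (hf μ hμ).mk f x else (hg μ hμ).mk g x,
      Measurable.ite ht (hf μ hμ).measurable_mk (hg μ hμ).measurable_mk, ?_⟩
    filter_upwards [(hf μ hμ).ae_eq_mk, (hg μ hμ).ae_eq_mk] with x h1 h2
    simp only [h1, h2]
  refine h1.congr ?_
  filter_upwards [hst] with x hx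
  have : x ∈ s ↔ x ∈ t := iff_of_eq hx
  simp only [this]

end UMBasics

section Capacitability

variable {Z : Type*} [TopologicalSpace Z] [PolishSpace Z] [MeasurableSpace Z] [BorelSpace Z]

theorem exists_isCompact_le_measure {f : (ℕ → ℕ) → Z} (hf : Continuous f) (μ : Measure Z)
    [IsProbabilityMeasure μ] {r : ℝ≥0∞} (hr : r < μ (Set.range f)) :
    ∃ K, IsCompact K ∧ K ⊆ Set.range f ∧ r ≤ μ K := by
  have step : ∀ (k : ℕ) (S : {S : Set (ℕ → ℕ) // r < μ (f '' S)}),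
      ∃ m, r < μ (f '' (S.1 ∩ {x | x k ≤ m})) := by
    rintro k ⟨S, hS⟩
    have hmono : Monotone fun m => f '' (S ∩ {x : ℕ → ℕ | x k ≤ m}) := by
      intro m m' hm
      refine Set.image_mono fun x hx => ⟨hx.1, hx.2.trans hm⟩
    have hU : (⋃ m, f '' (S ∩ {x : ℕ → ℕ | x k ≤ m})) = f '' S := by
      rw [← Set.image_iUnion, ← Set.inter_iUnion]
      congr 1
      refine Set.inter_eq_left.2 fun x _ => Set.mem_iUnion.2 ⟨x k, le_refl (x k)⟩
    rw [← hU, hmono.measure_iUnion] at hS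
    exact lt_iSup_iff.1 hS
  choose m hm using step
  let S : ℕ → {S : Set (ℕ → ℕ) // r < μ (f '' S)} := fun n => Nat.rec
    ⟨Set.univ, by rwa [Set.image_univ]⟩ (fun k S => ⟨S.1 ∩ {x | x k ≤ m k S}, hm k S⟩) n
  let b : ℕ → ℕ := fun k => m k (S k)
  have hSsub : ∀ n, ∀ x ∈ (S n).1, ∀ i < n, x i ≤ b i := by
    intro n
    induction n with
    | zero => intro x _ i hi; omega
    | succ n ih =>
      intro x hx i hi
      have hx' : x ∈ (S n).1 ∩ {x | x n ≤ m n (S n)} := hx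
      rcases Nat.lt_succ_iff_lt_or_eq.1 hi with h | rfl
      · exact ih x hx'.1 i h
      · exact hx'.2
  have hK : IsCompact {x : ℕ → ℕ | ∀ i, x i ≤ b i} := by
    have : {x : ℕ → ℕ | ∀ i, x i ≤ b i} = Set.univ.pi fun i => Set.Iic (b i) := by
      ext x; simp 
      exact Iff.rfl
    rw [this]
    exact isCompact_univ_pi fun i => (Set.finite_Iic _).isCompact
  refine ⟨f '' {x | ∀ i, x i ≤ b i}, hK.image hf, Set.image_subset_range _ _, ?_⟩
  by_contra! hlt
  obtain ⟨U, hKU, hUo, hU⟩ := Set.exists_isOpen_lt_of_lt _ _ hlt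
  have key : ∃ k, f '' (S k).1 ⊆ U := by
    by_contra! hcon
    have hx : ∀ k, ∃ x ∈ (S k).1, f x ∉ U := by
      intro k
      obtain ⟨_, ⟨x, hx, rfl⟩, hxU⟩ := Set.not_subset.1 (hcon k)
      exact ⟨x, hx, hxU⟩
    choose x hxS hxU using hx
    obtain ⟨y, hy, φ, hφ, hlim⟩ := hK.tendsto_subseq (x := fun k i => min (x k i) (b i))
      (fun k i => min_le_right _ _)
    have hlim2 : Tendsto (fun k => x (φ k)) atTop (𝓝 y) := by
      rw [tendsto_pi_nhds] at hlim ⊢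
      intro i
      refine (hlim i).congr' ?_
      filter_upwards [eventually_gt_atTop i] with k hk
      have : i < φ k := lt_of_lt_of_le hk (hφ.id_le k)
      exact min_eq_left (hSsub _ _ (hxS _) i this)
    have h3 : ∀ᶠ k in atTop, f (x (φ k)) ∈ U :=
      ((hf.tendsto y).comp hlim2).eventually (hUo.mem_nhds (hKU ⟨y, hy, rfl⟩))
    obtain ⟨k, hk⟩ := h3.exists
    exact hxU _ hk
  obtain ⟨k, hk⟩ := key
  exact absurd ((S k).2.trans_le (measure_mono hk)) hU.not_gt

theorem _root_.MeasureTheory.AnalyticSet.universallyMeasurableSet {s : Set Z}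
    (hs : AnalyticSet s) : UniversallyMeasurableSet s := by
  intro μ hμ
  rw [AnalyticSet] at hs
  rcases hs with rfl | ⟨f, hf, rfl⟩
  · exact MeasurableSet.empty.nullMeasurableSet
  rcases eq_or_ne (μ (Set.range f)) 0 with h0 | h0
  · exact NullMeasurableSet.of_null h0
  obtain ⟨u, -, hu, hlim⟩ := exists_seq_strictMono_tendsto' (pos_iff_ne_zero.2 h0)
  choose K hKc hKs hKm using fun n => exists_isCompact_le_measure hf μ (hu n).2
  have hm : MeasurableSet (⋃ n, K n) := MeasurableSet.iUnion fun n => (hKc n).measurableSet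
  have hge : μ (Set.range f) ≤ μ (⋃ n, K n) :=
    le_of_tendsto' hlim fun n => (hKm n).trans (measure_mono (Set.subset_iUnion _ _))
  exact hm.nullMeasurableSet.congr
    (ae_eq_of_subset_of_measure_ge (Set.iUnion_subset hKs) hge hm.nullMeasurableSet
      (measure_ne_top _ _))

end Capacitability

section Uniformization

theorem exists_firstNode {X : Type*} (E : List ℕ → Set X) (l : List ℕ) (x : X) :
    ∃ k : ℕ, x ∈ E (l ++ [k]) ∨ ∀ k' : ℕ, x ∉ E (l ++ [k']) := by
  by_cases h : ∃ k, x ∈ E (l ++ [k])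
  · exact ⟨h.choose, Or.inl h.choose_spec⟩
  · exact ⟨0, Or.inr fun k hk => h ⟨k, hk⟩⟩

open Classical in
/-- The first successor of the node `l` that lies in the scheme `E` at `x`. -/
def firstNode {X : Type*} (E : List ℕ → Set X) (l : List ℕ) (x : X) : ℕ :=
  Nat.find (exists_firstNode E l x)

/-- The leftmost branch of the scheme `E` at `x`, truncated at length `n`. -/
def leftBranch {X : Type*} (E : List ℕ → Set X) : ℕ → X → List ℕ
  | 0, _ => []
  | n + 1, x => leftBranch E n x ++ [firstNode E (leftBranch E n x) x]

variable {X : Type*} {E : List ℕ → Set X}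

theorem mem_firstNode {l : List ℕ} {x : X} (h : ∃ k, x ∈ E (l ++ [k])) :
    x ∈ E (l ++ [firstNode E l x]) := by
  classical
  rcases Nat.find_spec (exists_firstNode E l x) with h1 | h1
  · exact h1
  · exact absurd h.choose_spec (h1 _)

theorem measurable_firstNode [MeasurableSpace X] (hE : ∀ l, MeasurableSet (E l)) (l : List ℕ) :
    Measurable (firstNode E l) := by
  classical
  refine measurable_find (exists_firstNode E l) fun k => ?_
  refine (hE _).union ?_
  have : {x | ∀ k' : ℕ, x ∉ E (l ++ [k'])} = ⋂ k' : ℕ, (E (l ++ [k']))ᶜ := by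
    ext; simp
  exact (congrArg MeasurableSet this).mpr (MeasurableSet.iInter fun k' => (hE _).compl)

theorem measurable_leftBranch [MeasurableSpace X] (hE : ∀ l, MeasurableSet (E l)) :
    (∀ n, Measurable[_, ⊤] (leftBranch E n)) ∧
      ∀ n, Measurable fun x => firstNode E (leftBranch E n x) x := by
  let _ : MeasurableSpace (List ℕ) := ⊤
  have h1 : Measurable fun p : List ℕ × X => firstNode E p.1 p.2 :=
    measurable_from_prod_countable_right fun l => measurable_firstNode hE l
  have h2 : ∀ n, Measurable (leftBranch E n) := by
    intro n
    induction n with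
    | zero => exact measurable_const
    | succ n ih =>
      have h3 : Measurable fun p : List ℕ × ℕ => p.1 ++ [p.2] :=
        measurable_from_prod_countable_right fun l => measurable_of_countable _
      exact h3.comp (ih.prodMk (h1.comp (ih.prodMk measurable_id)))
  exact ⟨h2, fun n => h1.comp ((h2 n).prodMk measurable_id)⟩

variable [TopologicalSpace X] [PolishSpace X] [MeasurableSpace X] [BorelSpace X]

theorem exists_um_rightInverse {g : (ℕ → ℕ) → X} (hg : Continuous g) :
    ∃ s : X → ℕ → ℕ, UM s ∧ ∀ x ∈ Set.range g, g (s x) = x := by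
  let cyl : List ℕ → Set (ℕ → ℕ) := fun l => {z | (List.range l.length).map z = l}
  let E : List ℕ → Set X := fun l => g '' cyl l
  have hcyl : ∀ l, IsClosed (cyl l) := by
    intro l
    have : cyl l = ⋂ i : Fin l.length, {z : ℕ → ℕ | z i = l[i]} := by
      ext z
      simp only [cyl, Set.mem_ofPred_eq, Set.mem_iInter]
      constructor
      · intro h i
        have := congrArg (fun l' : List ℕ => l'[i.1]?) h
        simpa using this
      · intro h
        refine List.ext_getElem (by simp) fun i h1 h2 => ?_
        simpa using h ⟨i, h2⟩
    rw [this]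
    exact isClosed_iInter fun i => isClosed_eq (continuous_apply _) continuous_const
  have hE : ∀ l, UniversallyMeasurableSet (E l) := fun l =>
    ((hcyl l).analyticSet.image_of_continuous hg).universallyMeasurableSet
  refine ⟨fun x n => firstNode E (leftBranch E n x) x, ?_, ?_⟩
  · refine um_of_measurable_umSpace ?_
    refine @measurable_pi_lambda _ _ _ (umSpace X) _ _ fun n => ?_
    exact (@measurable_leftBranch X E (umSpace X) hE).2 n
  · intro x hx
    have hlen : ∀ n, (leftBranch E n x).length = n := by
      intro n
      induction n with
      | zero => rfl
      | succ n ih => simp [leftBranch, ih]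
    have hget : ∀ n, leftBranch E n x =
        (List.range n).map fun i => firstNode E (leftBranch E i x) x := by
      intro n
      induction n with
      | zero => rfl
      | succ n ih => rw [leftBranch, List.range_succ, List.map_append, ← ih]; rfl
    have hmem : ∀ n, x ∈ E (leftBranch E n x) := by
      intro n
      induction n with
      | zero =>
        obtain ⟨z, rfl⟩ := hx
        exact ⟨z, by simp [cyl, leftBranch], rfl⟩
      | succ n ih =>
        obtain ⟨z, hz, hzx⟩ := ih
        refine mem_firstNode ⟨z n, z, ?_, hzx⟩
        simp only [cyl, Set.mem_ofPred_eq, List.length_append, hlen, List.length_singleton,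
          List.range_succ, List.map_append] at hz ⊢
        rw [hz]; rfl
    choose z hz hzx using hmem
    have hlim : Tendsto z atTop (𝓝 fun n => firstNode E (leftBranch E n x) x) := by
      rw [tendsto_pi_nhds]
      intro i
      refine tendsto_const_nhds.congr' ?_
      filter_upwards [eventually_gt_atTop i] with n hn
      have h1 : (List.range (leftBranch E n x).length).map (z n) = leftBranch E n x := hz n
      rw [hlen, hget] at h1
      exact ((List.map_inj_left.1 h1) i (List.mem_range.2 hn)).symm
    have h2 := (hg.tendsto _).comp hlim
    refine tendsto_nhds_unique h2 ?_
    exact tendsto_const_nhds.congr fun n => (hzx n).symm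

/-- The Jankov–von Neumann selection theorem. -/
theorem _root_.MeasureTheory.AnalyticSet.exists_um_selector {Y : Type*} [TopologicalSpace Y]
    [PolishSpace Y] [MeasurableSpace Y] [BorelSpace Y] [Nonempty Y] {D : Set (X × Y)}
    (hD : AnalyticSet D) :
    ∃ φ : X → Y, UM φ ∧ ∀ x y, (x, y) ∈ D → (x, φ x) ∈ D := by
  rw [AnalyticSet] at hD
  rcases hD with rfl | ⟨f, hf, rfl⟩
  · exact ⟨fun _ => Classical.arbitrary Y, .of_measurable measurable_const, by simp⟩
  · obtain ⟨s, hs, hsg⟩ := exists_um_rightInverse (g := fun z => (f z).1) (by fun_prop)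
    refine ⟨fun x => (f (s x)).2, ?_, ?_⟩
    · exact Measurable.comp_um (g := fun z => (f z).2) (by fun_prop) hs
    · rintro x y ⟨z, hz⟩
      have := hsg x ⟨z, by simp [hz]⟩
      exact ⟨s x, Prod.ext this rfl⟩

end Uniformization

section Kernels

variable {α β : Type*} [MeasurableSpace α] [MeasurableSpace β]

theorem exists_countable_piSystem (β : Type*) [m : MeasurableSpace β]
    [MeasurableSpace.CountablyGenerated β] :
    ∃ S : Set (Set β), S.Countable ∧ IsPiSystem S ∧ m = MeasurableSpace.generateFrom S ∧
      ∀ s ∈ S, MeasurableSet s := by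
  have h : m = MeasurableSpace.generateFrom
      (generateSetAlgebra (MeasurableSpace.countableGeneratingSet β)) := by
    rw [generateFrom_generateSetAlgebra_eq, MeasurableSpace.generateFrom_countableGeneratingSet]
  refine ⟨_, countable_generateSetAlgebra (MeasurableSpace.countable_countableGeneratingSet (α := β)),
    isSetAlgebra_generateSetAlgebra.isSetRing.isSetSemiring.isPiSystem, h, fun s hs => ?_⟩
  rw [h]
  exact MeasurableSpace.measurableSet_generateFrom hs

theorem um_measure [MeasurableSpace.CountablyGenerated β] {κ : α → Measure β}
    (hp : ∀ x, IsProbabilityMeasure (κ x))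
    (hκ : ∀ B, MeasurableSet B → UM fun x => κ x B) : UM κ := by
  classical
  intro μ hμ
  rcases isEmpty_or_nonempty α with he | ⟨⟨x₀⟩⟩
  · exact (measurable_of_empty κ).aemeasurable
  obtain ⟨S, hSc, hSpi, hSg, hSm⟩ := exists_countable_piSystem β
  have hS : ∀ s : S, AEMeasurable (fun x => κ x s.1) μ := fun s => hκ _ (hSm _ s.2) μ hμ
  have hall : ∀ᵐ x ∂μ, ∀ s : S, κ x s.1 = (hS s).mk _ x := by
    have : Countable S := hSc.to_subtype
    exact ae_all_iff.2 fun s => (hS s).ae_eq_mk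
  obtain ⟨N, hsub, hNm, hN0⟩ := exists_measurable_superset_of_null hall
  refine ⟨fun x => if x ∈ N then κ x₀ else κ x, ?_, ?_⟩
  · have hp' : ∀ x, IsProbabilityMeasure (if x ∈ N then κ x₀ else κ x) := by
      intro x; split_ifs <;> exact hp _
    refine Measurable.measure_of_isPiSystem_of_isProbabilityMeasure hSg hSpi fun s hs => ?_
    have : (fun x => (if x ∈ N then κ x₀ else κ x) s) =
        fun x => if x ∈ N then κ x₀ s else (hS ⟨s, hs⟩).mk _ x := by
      ext x
      split_ifs with hx
      · rfl
      · by_contra hne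
        exact hx (hsub fun hall => hne (hall ⟨s, hs⟩))
    rw [this]
    exact Measurable.ite hNm measurable_const (hS ⟨s, hs⟩).measurable_mk
  · have : ∀ᵐ x ∂μ, x ∉ N := measure_eq_zero_iff_ae_notMem.1 hN0
    filter_upwards [this] with x hx
    rw [if_neg hx]

theorem UM.measure_apply {κ : α → Measure β} (hκ : UM κ) {B : Set β} (hB : MeasurableSet B) :
    UM fun x => κ x B :=
  Measurable.comp_um (Measure.measurable_coe hB) hκ

theorem measurableSet_kernel_eq [MeasurableSpace.CountablyGenerated β] {κ η : α → Measure β}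
    (hκ : Measurable κ) (hη : Measurable η) (hκf : ∀ x, IsFiniteMeasure (κ x)) :
    MeasurableSet {x | κ x = η x} := by
  obtain ⟨S, hSc, hSpi, hSg, hSm⟩ := exists_countable_piSystem β
  have : {x | κ x = η x} =
      (⋂ s ∈ S, {x | κ x s = η x s}) ∩ {x | κ x Set.univ = η x Set.univ} := by
    ext x
    simp only [Set.mem_ofPred_eq, Set.mem_inter_iff, Set.mem_iInter]
    constructor
    · intro h; simp [h]
    · rintro ⟨h1, h2⟩
      have := hκf x
      exact ext_of_generate_finite S hSg hSpi h1 h2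
  rw [this]
  refine (MeasurableSet.biInter hSc fun s hs => ?_).inter ?_
  · exact measurableSet_eq_fun ((Measure.measurable_coe (hSm s hs)).comp hκ)
      ((Measure.measurable_coe (hSm s hs)).comp hη)
  · exact measurableSet_eq_fun ((Measure.measurable_coe .univ).comp hκ)
      ((Measure.measurable_coe .univ).comp hη)

end Kernels

section Parametrization

variable (Z : Type*) [MeasurableSpace Z] [StandardBorelSpace Z] [Nonempty Z]

/-- A kernel over `ℚ → ℝ` that produces all probability measures on the line. -/
def realParam : Kernel (ℚ → ℝ) ℝ where
  toFun t := (stieltjesOfMeasurableRat (fun s : ℚ → ℝ => s) measurable_id t).measure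
  measurable' := measurable_measure_stieltjesOfMeasurableRat measurable_id

instance : IsMarkovKernel realParam where
  isProbabilityMeasure t :=
    ⟨measure_stieltjesOfMeasurableRat_univ (f := fun s : ℚ → ℝ => s) measurable_id t⟩

theorem exists_realParam_eq (p : Measure ℝ) [IsProbabilityMeasure p] :
    ∃ t, realParam t = p := by
  refine ⟨fun r => cdf p r, ?_⟩
  have hst : IsRatStieltjesPoint (fun s : ℚ → ℝ => s) (fun r => cdf p r) := by
    refine ⟨fun a b h => monotone_cdf p (by exact_mod_cast h),
      (tendsto_cdf_atTop p).comp (tendsto_ratCast_atTop_iff.2 tendsto_id),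
      (tendsto_cdf_atBot p).comp (tendsto_ratCast_atBot_iff.2 tendsto_id), fun t => ?_⟩
    refine Eq.trans ?_ ((cdf p).iInf_rat_gt_eq t)
    exact (Equiv.subtypeEquivRight fun r => by simp).iInf_congr fun _ => rfl
  have : stieltjesOfMeasurableRat (fun s : ℚ → ℝ => s) measurable_id (fun r => cdf p r) = cdf p := by
    ext x
    rw [← StieltjesFunction.iInf_rat_gt_eq, ← StieltjesFunction.iInf_rat_gt_eq]
    refine iInf_congr fun r => ?_
    rw [stieltjesOfMeasurableRat_eq, toRatCDF_of_isRatStieltjesPoint hst]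
  change (stieltjesOfMeasurableRat (fun s : ℚ → ℝ => s) measurable_id (fun r => cdf p r)).measure = p
  rw [this, measure_cdf]

/-- A kernel over `ℚ → ℝ` that produces all probability measures on a standard Borel space. -/
def param : Kernel (ℚ → ℝ) Z := Kernel.borelMarkovFromReal Z realParam

instance : IsMarkovKernel (param Z) := by unfold param; infer_instance

variable {Z}

theorem exists_param_eq (p : Measure Z) [IsProbabilityMeasure p] : ∃ t, param Z t = p := by
  have he := measurableEmbedding_embeddingReal Z
  have : IsProbabilityMeasure (p.map (embeddingReal Z)) :=
    Measure.isProbabilityMeasure_map he.measurable.aemeasurable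
  obtain ⟨t, ht⟩ := exists_realParam_eq (p.map (embeddingReal Z))
  refine ⟨t, ?_⟩
  rw [param, Kernel.borelMarkovFromReal_apply, ht, if_pos]
  · exact he.comap_map p
  · rw [Measure.map_apply he.measurable he.measurableSet_range.compl]
    convert measure_empty (μ := p)
    ext x; simp

end Parametrization

section Analytic

variable {Y Z : Type*} [TopologicalSpace Y] [PolishSpace Y] [MeasurableSpace Y] [BorelSpace Y]
  [TopologicalSpace Z] [PolishSpace Z] [MeasurableSpace Z] [BorelSpace Z]

theorem _root_.MeasureTheory.AnalyticSet.inter {Y : Type*} [TopologicalSpace Y] [T2Space Y]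
    {s t : Set Y} (hs : AnalyticSet s) (ht : AnalyticSet t) : AnalyticSet (s ∩ t) := by
  rw [Set.inter_eq_iInter]
  exact AnalyticSet.iInter fun b => by cases b <;> assumption

theorem _root_.MeasureTheory.AnalyticSet.union {Y : Type*} [TopologicalSpace Y]
    {s t : Set Y} (hs : AnalyticSet s) (ht : AnalyticSet t) : AnalyticSet (s ∪ t) := by
  rw [Set.union_eq_iUnion]
  exact AnalyticSet.iUnion fun b => by cases b <;> assumption

theorem analyticSet_univ : AnalyticSet (Set.univ : Set Y) := isClosed_univ.analyticSet

theorem _root_.MeasureTheory.AnalyticSet.of_measurableSet {s : Set Y} (hs : MeasurableSet s) :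
    AnalyticSet s := hs.analyticSet

theorem analyticSet_const (p : Prop) : AnalyticSet {_y : Y | p} :=
  (MeasurableSet.const p).analyticSet

theorem _root_.MeasureTheory.AnalyticSet.exists {D : Set (Y × Z)} (hD : AnalyticSet D) :
    AnalyticSet {y | ∃ z, (y, z) ∈ D} := by
  have : {y | ∃ z, (y, z) ∈ D} = Prod.fst '' D := by ext; simp
  rw [this]
  exact hD.image_of_continuous continuous_fst

theorem _root_.MeasureTheory.AnalyticSet.preimage_measurable {E : Set Z} (hE : AnalyticSet E)
    {f : Y → Z} (hf : Measurable f) : AnalyticSet (f ⁻¹' E) := by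
  have h1 : AnalyticSet ({p : Y × Z | f p.1 = p.2} ∩ Prod.snd ⁻¹' E) :=
    (measurableSet_eq_fun (hf.comp measurable_fst) measurable_snd).analyticSet.inter
      (hE.preimage continuous_snd)
  convert h1.exists using 1
  ext y
  simp

theorem analyticSet_le_kernel (K : Kernel Y Z) [IsMarkovKernel K] {E : Set Z} (hE : AnalyticSet E)
    (r : ℝ≥0∞) : AnalyticSet {y | r ≤ K y E} := by
  have hE' := hE.universallyMeasurableSet
  rw [AnalyticSet] at hE
  rcases hE with rfl | ⟨f, hf, rfl⟩
  · simpa using analyticSet_const (Y := Y) (r = 0)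
  rcases isEmpty_or_nonempty Z with hZ | hZ
  · simpa [Set.eq_empty_of_isEmpty] using analyticSet_const (Y := Y) (r = 0)
  obtain ⟨s, hs, hsf⟩ := exists_um_rightInverse hf
  let W := Z × (ℕ → ℕ)
  let D : Set (Y × (ℚ → ℝ)) := {p | (param W p.2).map Prod.fst = K p.1} ∩
    {p | r ≤ param W p.2 {w : W | f w.2 = w.1}}
  have hDm : MeasurableSet {w : W | f w.2 = w.1} :=
    measurableSet_eq_fun (hf.measurable.comp measurable_snd) measurable_fst
  have hD : MeasurableSet D := by
    refine MeasurableSet.inter ?_ ?_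
    · refine measurableSet_kernel_eq ?_ ?_ ?_
      · exact (Measure.measurable_map _ measurable_fst).comp
          ((param W).measurable.comp measurable_snd)
      · exact K.measurable.comp measurable_fst
      · intro p
        infer_instance
    · exact measurableSet_le measurable_const
        (((param W).measurable_coe hDm).comp measurable_snd)
  convert hD.analyticSet.exists using 1
  ext y
  constructor
  · intro hy
    have hsm := hs (K y) inferInstance
    have hm : AEMeasurable (fun z => (z, s z)) (K y) := aemeasurable_id.prodMk hsm
    have : IsProbabilityMeasure ((K y).map fun z => (z, s z)) := Measure.isProbabilityMeasure_map hm
    obtain ⟨t, ht⟩ := exists_param_eq ((K y).map fun z => (z, s z))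
    refine ⟨t, ?_, ?_⟩
    · change (param W t).map Prod.fst = K y
      rw [ht, AEMeasurable.map_map_of_aemeasurable measurable_fst.aemeasurable hm]
      exact Measure.map_id
    · change r ≤ param W t _
      rw [ht, Measure.map_apply_of_aemeasurable hm hDm]
      refine le_trans hy (measure_mono ?_)
      intro z hz
      exact hsf z hz
  · rintro ⟨t, h1, h2⟩
    change (param W t).map Prod.fst = K y at h1
    change r ≤ param W t _ at h2
    change r ≤ K y (Set.range f)
    rw [← h1]
    refine h2.trans ((measure_mono ?_).trans (Measure.le_map_apply measurable_fst.aemeasurable _))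
    intro w hw
    exact ⟨w.2, hw⟩

theorem analyticSet_le_kernel_section (K : Kernel Y Z) [IsMarkovKernel K] {E : Set (Y × Z)}
    (hE : AnalyticSet E) (r : ℝ≥0∞) : AnalyticSet {y | r ≤ K y {z | (y, z) ∈ E}} := by
  convert analyticSet_le_kernel (Kernel.id ×ₖ K) hE r using 3 with y
  rw [Kernel.prod_apply, Kernel.id_apply, Measure.dirac_prod, Measure.map_apply₀
    measurable_prodMk_left.aemeasurable]
  · rfl
  · have : IsProbabilityMeasure ((K y).map (Prod.mk y)) :=
      Measure.isProbabilityMeasure_map measurable_prodMk_left.aemeasurable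
    exact hE.universallyMeasurableSet _ this

end Analytic

section LSA

variable {Y Z L : Type*} [TopologicalSpace Y] [TopologicalSpace Z]

/-- Lower semianalyticity for functions into a linear order. -/
def LSA [LT L] (f : Y → L) : Prop := ∀ v, AnalyticSet {x | f x < v}

variable [PolishSpace Y] [MeasurableSpace Y] [BorelSpace Y]
  [PolishSpace Z] [MeasurableSpace Z] [BorelSpace Z]
  [CompleteLinearOrder L] [DenselyOrdered L] [TopologicalSpace L] [OrderTopology L]
  [SecondCountableTopology L]

theorem LSA.le {f : Y → L} (hf : LSA f) (v : L) : AnalyticSet {x | f x ≤ v} := by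
  rcases eq_or_ne v ⊤ with rfl | hv
  · simpa using analyticSet_univ
  obtain ⟨u, -, hu, hlim⟩ := exists_seq_strictAnti_tendsto' (lt_top_iff_ne_top.2 hv)
  have : {x | f x ≤ v} = ⋂ n, {x | f x < u n} := by
    ext x
    simp only [Set.mem_ofPred_eq, Set.mem_iInter]
    exact ⟨fun h n => h.trans_lt (hu n).1, fun h => ge_of_tendsto' hlim fun n => (h n).le⟩
  rw [this]
  exact AnalyticSet.iInter fun n => hf _

theorem LSA.of_le {f : Y → L} (hf : ∀ v, AnalyticSet {x | f x ≤ v}) : LSA f := by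
  intro v
  rcases eq_or_ne v ⊥ with rfl | hv
  · simpa using analyticSet_empty
  obtain ⟨u, -, hu, hlim⟩ := exists_seq_strictMono_tendsto' (bot_lt_iff_ne_bot.2 hv)
  have : {x | f x < v} = ⋃ n, {x | f x ≤ u n} := by
    ext x
    simp only [Set.mem_ofPred_eq, Set.mem_iUnion]
    constructor
    · intro h
      obtain ⟨n, hn⟩ := (hlim.eventually (lt_mem_nhds h)).exists
      exact ⟨n, hn.le⟩
    · rintro ⟨n, hn⟩
      exact hn.trans_lt (hu n).2
  rw [this]
  exact AnalyticSet.iUnion fun n => hf _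

theorem LSA.iInf {ι : Type*} [Countable ι] {f : ι → Y → L} (hf : ∀ i, LSA (f i)) :
    LSA fun y => ⨅ i, f i y := by
  intro v
  have : {x | ⨅ i, f i x < v} = ⋃ i, {x | f i x < v} := by
    ext x; simp [iInf_lt_iff]
  rw [this]
  exact AnalyticSet.iUnion fun i => hf i v

theorem LSA.iSup {ι : Type*} [Countable ι] {f : ι → Y → L} (hf : ∀ i, LSA (f i)) :
    LSA fun y => ⨆ i, f i y := by
  refine LSA.of_le fun v => ?_
  rcases isEmpty_or_nonempty ι with hι | hι
  · simpa using analyticSet_univ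
  have : {x | ⨆ i, f i x ≤ v} = ⋂ i, {x | f i x ≤ v} := by
    ext x; simp
  rw [this]
  exact AnalyticSet.iInter fun i => (hf i).le v

theorem LSA.limsup {f : ℕ → Y → L} (hf : ∀ i, LSA (f i)) :
    LSA fun y => limsup (fun n => f n y) atTop := by
  simp only [limsup_eq_iInf_iSup_of_nat']
  exact LSA.iInf fun n => LSA.iSup fun i => hf _

theorem LSA.comp_measurable {f : Z → L} (hf : LSA f) {g : Y → Z} (hg : Measurable g) :
    LSA fun y => f (g y) := fun v => (hf v).preimage_measurable hg

theorem eq_univ_or_Iio_of_isOpen {O : Set L} (hl : IsLowerSet O) (ho : IsOpen O) :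
    O = Set.univ ∨ ∃ u, O = Set.Iio u := by
  by_cases h : sSup O ∈ O
  · left
    rcases eq_or_ne (sSup O) ⊤ with ht | ht
    · rw [ht] at h
      exact Set.eq_univ_of_forall fun x => hl le_top h
    · obtain ⟨l, hl1, hl2⟩ := exists_Ico_subset_of_mem_nhds (ho.mem_nhds h)
        ⟨⊤, lt_top_iff_ne_top.2 ht⟩
      obtain ⟨m, hm1, hm2⟩ := exists_between hl1
      exact absurd (le_sSup (hl2 ⟨hm1.le, hm2⟩)) hm1.not_ge
  · right
    refine ⟨sSup O, Set.ext fun x => ⟨fun hx => ?_, fun hx => ?_⟩⟩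
    · exact lt_of_le_of_ne (le_sSup hx) fun hxe => h (hxe ▸ hx)
    · obtain ⟨y, hy, hxy⟩ := lt_sSup_iff.1 hx
      exact hl hxy.le hy

theorem LSA.monotone_comp {L' : Type*} [LinearOrder L'] [TopologicalSpace L']
    [OrderClosedTopology L'] {f : Y → L} (hf : LSA f) {F : L → L'} (hF : Monotone F)
    (hFc : Continuous F) : LSA fun y => F (f y) := by
  intro v
  have hl : IsLowerSet (F ⁻¹' Set.Iio v) := fun a b hba ha => (hF hba).trans_lt ha
  rcases eq_univ_or_Iio_of_isOpen hl (isOpen_Iio.preimage hFc) with h | ⟨u, hu⟩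
  · have : {y | F (f y) < v} = f ⁻¹' (F ⁻¹' Set.Iio v) := rfl
    rw [this, h]
    exact analyticSet_univ
  · have : {y | F (f y) < v} = f ⁻¹' (F ⁻¹' Set.Iio v) := rfl
    rw [this, hu]
    exact hf u

variable [MeasurableSpace L] [BorelSpace L]

theorem LSA.um {f : Y → L} (hf : LSA f) : UM f :=
  um_of_measurable_umSpace (@measurable_of_Iio _ _ _ _ _ (umSpace Y) _ _ _ _
    fun v => (hf v).universallyMeasurableSet)

theorem LSA.epigraph [PolishSpace L] {f : Y → L} (hf : LSA f) :
    AnalyticSet {p : Y × L | f p.1 ≤ p.2} := by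
  obtain ⟨S, hSc, hSd⟩ := TopologicalSpace.exists_countable_dense L
  have hS : Countable S := hSc.to_subtype
  rcases isEmpty_or_nonempty S with h0 | h0
  · have : {p : Y × L | f p.1 ≤ p.2} = Set.univ := by
      refine Set.eq_univ_of_forall fun p => ?_
      by_contra hlt
      obtain ⟨z, hz, -⟩ := hSd.exists_between (not_le.1 hlt)
      exact h0.elim ⟨z, hz⟩
    rw [this]
    exact analyticSet_univ
  have : {p : Y × L | f p.1 ≤ p.2} = ⋂ s : S, ({p | s.1 ≤ p.2} ∪ {p | f p.1 < s.1}) := by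
    ext p
    simp only [Set.mem_ofPred_eq, Set.mem_iInter, Set.mem_union]
    constructor
    · intro h s
      rcases le_or_gt s.1 p.2 with h1 | h1
      · exact Or.inl h1
      · exact Or.inr (h.trans_lt h1)
    · intro h
      by_contra hlt
      obtain ⟨z, hz, hz1, hz2⟩ := hSd.exists_between (not_le.1 hlt)
      rcases h ⟨z, hz⟩ with h1 | h1
      · exact absurd hz1 h1.not_gt
      · exact absurd hz2 h1.not_gt
  rw [this]
  refine AnalyticSet.iInter fun s => ?_
  exact (isClosed_le continuous_const continuous_snd).analyticSet.union
    ((hf s.1).preimage continuous_fst)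

theorem LSA.lintegral {F : Z → ℝ≥0∞} (hF : LSA F) (K : Kernel Y Z) [IsMarkovKernel K] :
    LSA fun y => ∫⁻ z, F z ∂(K y) := by
  refine LSA.of_le fun v => ?_
  rcases isEmpty_or_nonempty Z with hZ | hZ
  · simpa [lintegral_of_isEmpty] using analyticSet_univ
  let W := Z × ℝ≥0∞
  let D : Set (Y × (ℚ → ℝ)) := ({p | (param W p.2).map Prod.fst = K p.1} ∩
    {p | ∫⁻ w, w.2 ∂(param W p.2) ≤ v}) ∩ {p | 1 ≤ param W p.2 {w : W | F w.1 ≤ w.2}}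
  have hD : AnalyticSet D := by
    refine AnalyticSet.inter (MeasurableSet.inter ?_ ?_).analyticSet ?_
    · refine measurableSet_kernel_eq ?_ ?_ ?_
      · exact (Measure.measurable_map _ measurable_fst).comp
          ((param W).measurable.comp measurable_snd)
      · exact K.measurable.comp measurable_fst
      · intro p
        infer_instance
    · exact measurableSet_le ((Measure.measurable_lintegral measurable_snd).comp
          ((param W).measurable.comp measurable_snd)) measurable_const
    · exact (analyticSet_le_kernel (param W) hF.epigraph 1).preimage continuous_snd
  convert hD.exists using 1
  ext y
  constructor
  · intro hy
    have hFm := hF.um (K y) inferInstance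
    have hm : AEMeasurable (fun z => (z, F z)) (K y) := aemeasurable_id.prodMk hFm
    have : IsProbabilityMeasure ((K y).map fun z => (z, F z)) := Measure.isProbabilityMeasure_map hm
    obtain ⟨t, ht⟩ := exists_param_eq ((K y).map fun z => (z, F z))
    refine ⟨t, ⟨?_, ?_⟩, ?_⟩
    · change (param W t).map Prod.fst = K y
      rw [ht, AEMeasurable.map_map_of_aemeasurable measurable_fst.aemeasurable hm]
      exact Measure.map_id
    · change ∫⁻ w, w.2 ∂(param W t) ≤ v
      rwa [ht, lintegral_map' measurable_snd.aemeasurable hm]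
    · change 1 ≤ param W t _
      rw [ht]
      refine le_trans ?_ (Measure.le_map_apply hm _)
      have : (fun z => (z, F z)) ⁻¹' {w : W | F w.1 ≤ w.2} = Set.univ :=
        Set.eq_univ_of_forall fun z => le_refl (F z)
      rw [this, measure_univ]
  · rintro ⟨t, ⟨h1, h2⟩, h3⟩
    change (param W t).map Prod.fst = K y at h1
    change ∫⁻ w, w.2 ∂(param W t) ≤ v at h2
    change 1 ≤ param W t _ at h3
    change ∫⁻ z, F z ∂(K y) ≤ v
    have hn := hF.epigraph.universallyMeasurableSet (param W t) inferInstance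
    have hae : ∀ᵐ w ∂(param W t), F w.1 ≤ w.2 :=
      (prob_compl_eq_zero_iff₀ hn).2 (le_antisymm prob_le_one h3)
    rw [← h1, lintegral_map' (hF.um _ (by rw [h1]; infer_instance)) measurable_fst.aemeasurable]
    exact (lintegral_mono_ae hae).trans h2

end LSA

section ERealFacts

theorem ePos_eq_toENNReal (x : EReal) : ePos x = x.toENNReal := rfl

theorem continuous_const_mul_ereal (a : ℝ) : Continuous fun y : EReal => (a : EReal) * y := by
  rcases eq_or_ne a 0 with rfl | ha
  · simpa using continuous_const
  · have h0 : (a : EReal) ≠ 0 := by simpa using ha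
    refine continuous_iff_continuousAt.2 fun y => ?_
    have := EReal.continuousAt_mul (p := ((a : EReal), y)) (Or.inl h0) (Or.inl h0)
      (Or.inl (EReal.coe_ne_bot a)) (Or.inl (EReal.coe_ne_top a))
    exact this.comp (f := fun y : EReal => ((a : EReal), y)) (by fun_prop)

theorem continuous_const_add_ereal (a : ℝ) : Continuous fun y : EReal => (a : EReal) + y := by
  refine continuous_iff_continuousAt.2 fun y => ?_
  have := EReal.continuousAt_add (p := ((a : EReal), y)) (Or.inl (EReal.coe_ne_top a))
    (Or.inl (EReal.coe_ne_bot a))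
  exact this.comp (f := fun y : EReal => ((a : EReal), y)) (by fun_prop)

theorem monotone_avg (n : ℕ) : Monotone (avg n) := fun _ _ h =>
  mul_le_mul_of_nonneg_left h (by exact_mod_cast (by positivity : (0 : ℝ) ≤ (n : ℝ)⁻¹))

theorem continuous_avg (n : ℕ) : Continuous (avg n) := continuous_const_mul_ereal _

theorem esum_coe {n : ℕ} (x : Fin n → ℝ) :
    esum (fun k => (x k : EReal)) = ((∑ k, x k : ℝ) : EReal) := by
  have h1 : ∀ y : ℝ, ePos (y : EReal) = ENNReal.ofReal y := fun y => by simp [ePos]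
  have h2 : ∀ y : Fin n → ℝ, ∑ k, ePos (y k : EReal) = ENNReal.ofReal (∑ k, max (y k) 0) := by
    intro y
    rw [ENNReal.ofReal_sum_of_nonneg fun _ _ => le_max_right _ _]
    exact Finset.sum_congr rfl fun k _ => by simp [h1]
  have h3 := h2 fun k => -x k
  simp only [EReal.coe_neg] at h3
  rw [esum, h2, h3, if_neg ENNReal.ofReal_ne_top, EReal.coe_ennreal_ofReal, EReal.coe_ennreal_ofReal,
    max_eq_left (Finset.sum_nonneg fun _ _ => le_max_right _ _),
    max_eq_left (Finset.sum_nonneg fun _ _ => le_max_right _ _), ← EReal.coe_sub,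
    ← Finset.sum_sub_distrib]
  congr 1
  refine Finset.sum_congr rfl fun k _ => ?_
  rcases le_total 0 (x k) with h | h
  · simp [h]
  · simp [h]

theorem esum_eq_top {n : ℕ} {v : Fin n → EReal} {k : Fin n} (h : v k = ⊤) : esum v = ⊤ := by
  rw [esum, if_pos]
  refine ENNReal.sum_eq_top.2 ⟨k, Finset.mem_univ _, by simp [ePos, h]⟩

theorem esum_lt_iff {n : ℕ} {u : Fin n → EReal} (hb : ∀ k, u k ≠ ⊥) {v : EReal} :
    esum u < v ↔ ∃ r : Fin n → ℚ, ((∑ k, (r k : ℝ) : ℝ) : EReal) < v ∧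
      ∀ k, u k < ((r k : ℝ) : EReal) := by
  constructor
  · intro h
    have ht : ∀ k, u k ≠ ⊤ := fun k hk => by
      rw [esum_eq_top hk] at h
      exact not_top_lt h
    obtain ⟨x, rfl⟩ : ∃ x : Fin n → ℝ, u = fun k => (x k : EReal) :=
      ⟨fun k => (u k).toReal, funext fun k => (EReal.coe_toReal (ht k) (hb k)).symm⟩
    rw [esum_coe] at h
    obtain ⟨w, hw1, hw2⟩ := EReal.lt_iff_exists_real_btwn.1 h
    rw [EReal.coe_lt_coe_iff] at hw1
    set d := (w - ∑ k, x k) / (n + 1) with hd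
    have hdpos : 0 < d := div_pos (by linarith) (by positivity)
    choose r hr1 hr2 using fun k => exists_rat_btwn (show x k < x k + d by linarith)
    refine ⟨r, lt_of_le_of_lt ?_ hw2, fun k => EReal.coe_lt_coe_iff.2 (hr1 k)⟩
    rw [EReal.coe_le_coe_iff]
    calc ∑ k, (r k : ℝ) ≤ ∑ k, (x k + d) := Finset.sum_le_sum fun k _ => (hr2 k).le
      _ = ∑ k, x k + n * d := by simp [Finset.sum_add_distrib]
      _ ≤ ∑ k, x k + (n + 1) * d := by nlinarith
      _ = w := by rw [hd]; field_simp; ring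
  · rintro ⟨r, hr1, hr2⟩
    obtain ⟨x, rfl⟩ : ∃ x : Fin n → ℝ, u = fun k => (x k : EReal) :=
      ⟨fun k => (u k).toReal, funext fun k => (EReal.coe_toReal (hr2 k).ne_top (hb k)).symm⟩
    rw [esum_coe]
    refine lt_of_le_of_lt ?_ hr1
    rw [EReal.coe_le_coe_iff]
    exact Finset.sum_le_sum fun k _ => (EReal.coe_lt_coe_iff.1 (hr2 k)).le

end ERealFacts

section Risk

variable {Y X A : Type*} [TopologicalSpace Y] [PolishSpace Y] [MeasurableSpace Y] [BorelSpace Y]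
  [TopologicalSpace X] [PolishSpace X] [MeasurableSpace X] [BorelSpace X]
  [TopologicalSpace A] [PolishSpace A] [MeasurableSpace A] [BorelSpace A]

theorem LSA.esum {n : ℕ} {u : Fin n → Y → EReal} (hu : ∀ k, LSA (u k)) (hb : ∀ k y, u k y ≠ ⊥) :
    LSA fun y => esum fun k => u k y := by
  intro v
  have : {y | PaperStmt.esum (fun k => u k y) < v} =
      ⋃ r : {r : Fin n → ℚ // ((∑ k, (r k : ℝ) : ℝ) : EReal) < v},
        {y | ∀ k, u k y < ((r.1 k : ℝ) : EReal)} := by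
    ext y
    simp only [Set.mem_ofPred_eq, Set.mem_iUnion]
    rw [esum_lt_iff fun k => hb k y]
    constructor
    · rintro ⟨r, h1, h2⟩
      exact ⟨⟨r, h1⟩, h2⟩
    · rintro ⟨r, h⟩
      exact ⟨r.1, r.2, h⟩
  rw [this]
  refine AnalyticSet.iUnion fun r => ?_
  rcases isEmpty_or_nonempty (Fin n) with h | h
  · simpa using analyticSet_univ
  · have : {y | ∀ k, u k y < ((r.1 k : ℝ) : EReal)} = ⋂ k, {y | u k y < ((r.1 k : ℝ) : EReal)} := by
      ext; simp
    rw [this]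
    exact AnalyticSet.iInter fun k => hu k _

theorem LowerSemianalytic.lsa {f : Y → EReal} (hf : LowerSemianalytic f) : LSA f := by
  refine LSA.of_le fun v => ?_
  induction v with
  | bot =>
    have : {y | f y ≤ ⊥} = ⋂ n : ℕ, {y | f y ≤ ((-(n : ℝ) : ℝ) : EReal)} := by
      ext y
      simp only [Set.mem_ofPred_eq, Set.mem_iInter]
      constructor
      · intro h n
        exact h.trans bot_le
      · intro h
        by_contra hlt
        obtain ⟨w, -, hw⟩ := EReal.lt_iff_exists_real_btwn.1 (not_le.1 hlt)
        obtain ⟨n, hn⟩ := exists_nat_gt (-w)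
        have h1 := (hw.trans_le (h n))
        rw [EReal.coe_lt_coe_iff] at h1
        linarith
    rw [this]
    exact AnalyticSet.iInter fun n => hf _
  | coe r => exact hf r
  | top => simpa using analyticSet_univ

theorem LSA.lowerSemianalytic {f : Y → EReal} (hf : LSA f) : LowerSemianalytic f :=
  fun r => hf.le r

variable {c : X × A → EReal}

theorem lsa_pathSum (hc : LSA c) (hb : ∀ xa, c xa ≠ ⊥) (n j : ℕ) : LSA (pathSum c n j) :=
  LSA.esum (fun _ => hc.comp_measurable (measurable_pi_apply _)) fun _ _ => hb _

theorem lsa_cbar (hc : LSA c) (hb : ∀ xa, c xa ≠ ⊥) : LSA (cbar c) :=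
  LSA.limsup fun n => (lsa_pathSum hc hb n 0).monotone_comp (monotone_avg n) (continuous_avg n)

theorem lsa_certaintyEquivalent {Z : Type*} [TopologicalSpace Z] [PolishSpace Z]
    [MeasurableSpace Z] [BorelSpace Z] {F : Z → EReal} (hF : LSA F)
    {ψ : EReal → ℝ≥0∞} {ψinv : ℝ≥0∞ → EReal} (hψ : StrictMono ψ) (hψc : Continuous ψ)
    (hinv : ∀ y, ψinv (ψ y) = y) (K : Kernel Y Z) [IsMarkovKernel K] :
    LSA fun y => ψinv (∫⁻ z, ψ (F z) ∂(K y)) := by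
  intro v
  have h1 := (hF.monotone_comp hψ.monotone hψc).lintegral K (ψ v)
  convert h1 using 3 with y
  have hlo : ψ ⊥ ≤ ∫⁻ z, ψ (F z) ∂(K y) := by
    calc ψ ⊥ = ∫⁻ z, ψ ⊥ ∂(K y) := by simp
      _ ≤ _ := lintegral_mono fun z => hψ.monotone bot_le
  have hhi : ∫⁻ z, ψ (F z) ∂(K y) ≤ ψ ⊤ := by
    calc _ ≤ ∫⁻ z, ψ ⊤ ∂(K y) := lintegral_mono fun z => hψ.monotone le_top
      _ = ψ ⊤ := by simp
  obtain ⟨e, he⟩ := mem_range_of_exists_le_of_exists_ge hψc ⟨_, hlo⟩ ⟨_, hhi⟩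
  beta_reduce
  rw [← he, hinv, hψ.lt_iff_lt]

theorem lsa_Jpsi (hc : LSA c) (hb : ∀ xa, c xa ≠ ⊥) {ψ : EReal → ℝ≥0∞} {ψinv : ℝ≥0∞ → EReal}
    (hψ : StrictMono ψ) (hψc : Continuous ψ) (hinv : ∀ y, ψinv (ψ y) = y)
    (K : Kernel Y (Traj X A)) [IsMarkovKernel K] :
    LSA fun y => Jpsi c ψ ψinv ⟨K y, inferInstance⟩ :=
  LSA.limsup fun n => (lsa_certaintyEquivalent (lsa_pathSum hc hb n 0) hψ hψc hinv K).monotone_comp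
    (monotone_avg n) (continuous_avg n)

theorem lsa_JpsiHat (hc : LSA c) (hb : ∀ xa, c xa ≠ ⊥) {ψ : EReal → ℝ≥0∞} {ψinv : ℝ≥0∞ → EReal}
    (hψ : StrictMono ψ) (hψc : Continuous ψ) (hinv : ∀ y, ψinv (ψ y) = y)
    (K : Kernel Y (Traj X A)) [IsMarkovKernel K] :
    LSA fun y => JpsiHat c ψ ψinv ⟨K y, inferInstance⟩ :=
  LSA.limsup fun n => LSA.iSup fun j =>
    (lsa_certaintyEquivalent (lsa_pathSum hc hb n j) hψ hψc hinv K).monotone_comp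
      (monotone_avg n) (continuous_avg n)

theorem lsa_Rcvar (hc : LSA c) (hb : ∀ xa, c xa ≠ ⊥) {α : ℝ} (hα : 0 < α)
    (K : Kernel Y (Traj X A)) [IsMarkovKernel K] :
    LSA fun y => Rcvar c α ⟨K y, inferInstance⟩ := by
  have h1 : ∀ z : ℝ, LSA fun y => ((z : EReal) +
      (((ENNReal.ofReal α)⁻¹ * ∫⁻ ω, ePos (cbar c ω - (z : EReal)) ∂(K y) : ℝ≥0∞) : EReal)) := by
    intro z
    have h2 : LSA fun ω => ePos (cbar c ω - (z : EReal)) := by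
      refine (lsa_cbar hc hb).monotone_comp (F := fun e : EReal => ePos (e - (z : EReal))) ?_ ?_
      · intro a b hab
        simp only [ePos_eq_toENNReal]
        exact EReal.toENNReal_le_toENNReal (EReal.sub_le_sub hab le_rfl)
      · simp only [ePos_eq_toENNReal]
        refine Continuous.ereal_toENNReal ?_
        convert continuous_const_add_ereal (-z) using 2 with e
        rw [sub_eq_add_neg, add_comm, EReal.coe_neg]
    refine (h2.lintegral K).monotone_comp
      (F := fun e : ℝ≥0∞ => (z : EReal) + (((ENNReal.ofReal α)⁻¹ * e : ℝ≥0∞) : EReal)) ?_ ?_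
    · intro a b hab
      refine add_le_add le_rfl ?_
      exact EReal.coe_ennreal_le_coe_ennreal_iff.2 (by gcongr)
    · refine (continuous_const_add_ereal z).comp (continuous_coe_ennreal_ereal.comp ?_)
      exact ENNReal.continuous_const_mul (by simpa using hα)
  intro v
  have : {y | Rcvar c α ⟨K y, inferInstance⟩ < v} = ⋃ z : ℚ, {y | (((z : ℝ) : EReal) +
      (((ENNReal.ofReal α)⁻¹ * ∫⁻ ω, ePos (cbar c ω - ((z : ℝ) : EReal)) ∂(K y) : ℝ≥0∞) : EReal))
        < v} := by
    ext y
    simp only [Set.mem_ofPred_eq, Set.mem_iUnion, Rcvar, iInf_lt_iff, ProbabilityMeasure.coe_mk]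
    constructor
    · rintro ⟨z, hz⟩
      set I := (ENNReal.ofReal α)⁻¹ * ∫⁻ ω, ePos (cbar c ω - (z : EReal)) ∂(K y) with hI
      have hIt : I ≠ ⊤ := by
        intro h
        rw [h] at hz
        simp at hz
      lift I to ℝ≥0 using hIt with i
      have hz' : ((z + i : ℝ) : EReal) < v := by exact_mod_cast hz
      obtain ⟨w, hw1, hw2⟩ := EReal.lt_iff_exists_real_btwn.1 hz'
      rw [EReal.coe_lt_coe_iff] at hw1
      obtain ⟨z', hz1, hz2⟩ := exists_rat_btwn (show z < w - i by linarith)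
      refine ⟨z', lt_of_le_of_lt ?_ hw2⟩
      calc _ ≤ ((z' : ℝ) : EReal) + (((i : ℝ≥0) : ℝ≥0∞) : EReal) := by
            refine add_le_add le_rfl (EReal.coe_ennreal_le_coe_ennreal_iff.2 ?_)
            rw [hI]
            gcongr with ω
            simp only [ePos_eq_toENNReal]
            exact EReal.toENNReal_le_toENNReal
              (EReal.sub_le_sub le_rfl (EReal.coe_le_coe_iff.2 hz1.le))
        _ = (((z' : ℝ) + i : ℝ) : EReal) := rfl
        _ ≤ (w : EReal) := EReal.coe_le_coe_iff.2 (by linarith)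
    · rintro ⟨z, hz⟩
      exact ⟨z, hz⟩
  rw [this]
  exact AnalyticSet.iUnion fun z => h1 _ v

theorem lsa_Rvar (hc : LSA c) (hb : ∀ xa, c xa ≠ ⊥) (α : ℝ)
    (K : Kernel Y (Traj X A)) [IsMarkovKernel K] :
    LSA fun y => Rvar c α ⟨K y, inferInstance⟩ := by
  intro v
  have : {y | Rvar c α ⟨K y, inferInstance⟩ < v} = ⋃ z : {z : ℚ // ((z : ℝ) : EReal) < v},
      {y | 1 - ENNReal.ofReal α ≤ K y {ω | cbar c ω ≤ ((z.1 : ℝ) : EReal)}} := by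
    ext y
    simp only [Set.mem_ofPred_eq, Set.mem_iUnion, Rvar, iInf_lt_iff, ProbabilityMeasure.coe_mk]
    constructor
    · rintro ⟨z, hz, hzv⟩
      obtain ⟨z', h1, h2⟩ := EReal.lt_iff_exists_rat_btwn.1 hzv
      refine ⟨⟨z', h2⟩, hz.trans (measure_mono fun ω hω => ?_)⟩
      exact le_trans hω h1.le
    · rintro ⟨z, hz⟩
      exact ⟨z.1, hz, z.2⟩
  rw [this]
  exact AnalyticSet.iUnion fun z => analyticSet_le_kernel K ((lsa_cbar hc hb).le _) _

end Risk

section Selection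

variable {Y Z : Type*} [TopologicalSpace Y] [PolishSpace Y] [MeasurableSpace Y] [BorelSpace Y]
  [TopologicalSpace Z] [PolishSpace Z] [MeasurableSpace Z] [BorelSpace Z]

theorem lsa_partialInf {D : Set (Y × Z)} (hD : AnalyticSet D) {J : Z → EReal} (hJ : LSA J) :
    LSA fun y => ⨅ (z : Z) (_ : (y, z) ∈ D), J z := by
  intro v
  convert (hD.inter ((hJ v).preimage continuous_snd)).exists using 1
  ext y
  simp [iInf_lt_iff]

theorem exists_um_epsilonOptimal_selector [Nonempty Z] {D : Set (Y × Z)} (hD : AnalyticSet D)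
    (hne : ∀ y, ∃ z, (y, z) ∈ D) {J : Z → EReal} (hJ : LSA J) {g : Y → EReal}
    (hg : g = fun y => ⨅ (z : Z) (_ : (y, z) ∈ D), J z) {ε : ℝ} (hε : 0 < ε) :
    ∃ φ : Y → Z, UM φ ∧ (∀ y, (y, φ y) ∈ D) ∧
      (∀ y, (g y ≠ ⊥ → J (φ y) ≤ g y + (ε : EReal)) ∧
        (g y = ⊥ → J (φ y) ≤ ((-ε⁻¹ : ℝ) : EReal))) ∧
      (∀ y, (∃ z, (y, z) ∈ D ∧ J z = g y) → J (φ y) = g y) := by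
  classical
  have hgm : UM g := hg ▸ (lsa_partialInf hD hJ).um
  let E : Set ((Y × EReal) × Z) := {p | (p.1.1, p.2) ∈ D} ∩ {p | J p.2 ≤ p.1.2}
  have hE : AnalyticSet E := by
    refine (hD.preimage (f := fun p : (Y × EReal) × Z => (p.1.1, p.2)) (by fun_prop)).inter ?_
    exact hJ.epigraph.preimage (f := fun p : (Y × EReal) × Z => (p.2, p.1.2)) (by fun_prop)
  obtain ⟨φ₀, hφ₀, hsel⟩ := hE.exists_um_selector
  let S : Set Y := {y | ∃ z, (y, z) ∈ D ∧ J z ≤ g y}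
  have hS : UniversallyMeasurableSet S := by
    have h1 : AnalyticSet {p | ∃ z, (p, z) ∈ E} := hE.exists
    exact h1.universallyMeasurableSet.preimage (f := fun y => (y, g y))
      ((UM.of_measurable measurable_id).prodMk hgm)
  have hB : UniversallyMeasurableSet {y | g y = ⊥} := fun μ hμ =>
    (hgm μ hμ).nullMeasurable (measurableSet_singleton ⊥)
  let b : Y → EReal := fun y => if y ∈ S then g y else
    if y ∈ {y | g y = ⊥} then ((-ε⁻¹ : ℝ) : EReal) else g y + (ε : EReal)
  have hb : UM b := UM.ite hS hgm (UM.ite hB (.of_measurable measurable_const)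
    (Measurable.comp_um (g := fun e : EReal => e + (ε : EReal)) (by fun_prop) hgm))
  have hex : ∀ y, ∃ z, (y, z) ∈ D ∧ J z ≤ b y := by
    intro y
    by_cases hyS : y ∈ S
    · simp only [b, if_pos hyS]
      exact hyS
    · have hlt : g y < b y := by
        simp only [b, if_neg hyS]
        split_ifs with hbot
        · rw [show g y = ⊥ from hbot]
          exact EReal.bot_lt_coe _
        · have htop : g y ≠ ⊤ := by
            intro ht
            obtain ⟨z, hz⟩ := hne y
            exact hyS ⟨z, hz, ht ▸ le_top⟩
          lift g y to ℝ using ⟨htop, hbot⟩ with w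
          rw [← EReal.coe_add, EReal.coe_lt_coe_iff]
          linarith
      have h2 : (⨅ (z : Z) (_ : (y, z) ∈ D), J z) < b y := by rwa [hg] at hlt
      simp only [iInf_lt_iff] at h2
      obtain ⟨z, hz, hzb⟩ := h2
      exact ⟨z, hz, hzb.le⟩
  have hφ : ∀ y, (y, φ₀ (y, b y)) ∈ D ∧ J (φ₀ (y, b y)) ≤ b y := by
    intro y
    obtain ⟨z, hz, hzb⟩ := hex y
    exact hsel (y, b y) z ⟨hz, hzb⟩
  have hge : ∀ y z, (y, z) ∈ D → g y ≤ J z := by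
    intro y z hz
    rw [hg]
    exact iInf₂_le z hz
  refine ⟨fun y => φ₀ (y, b y), hφ₀.comp ((UM.of_measurable measurable_id).prodMk hb),
    fun y => (hφ y).1, fun y => ⟨fun hy => ?_, fun hy => ?_⟩, ?_⟩
  · refine (hφ y).2.trans ?_
    simp only [b]
    split_ifs with h1 h2
    · exact le_add_of_nonneg_right (by exact_mod_cast hε.le)
    · exact absurd h2 hy
    · exact le_rfl
  · refine (hφ y).2.trans ?_
    simp only [b]
    split_ifs with h1 h2
    · rw [hy]; exact bot_le
    · exact le_rfl
    · exact absurd hy h2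
  · rintro y ⟨z, hz, hzg⟩
    have hyS : y ∈ S := ⟨z, hz, hzg.le⟩
    refine le_antisymm ((hφ y).2.trans ?_) (hge _ _ (hφ y).1)
    simp only [b, if_pos hyS, le_refl]

end Selection

section Adjoin

variable {α β : Type*} [MeasurableSpace α] [MeasurableSpace β]

theorem UM.exists_markovKernel {m : α → Measure β} (hm : UM m) (hp : ∀ a, IsProbabilityMeasure (m a))
    (ρ : Measure α) [IsFiniteMeasure ρ] :
    ∃ κ : Kernel α β, IsMarkovKernel κ ∧ ∀ᵐ a ∂ρ, m a = κ a := by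
  classical
  rcases isEmpty_or_nonempty α with hα | ⟨⟨a₀⟩⟩
  · exact ⟨0, ⟨fun a => isEmptyElim a⟩, Eventually.of_forall fun a => isEmptyElim a⟩
  have h1 := hm.aemeasurable_of_finite ρ
  set g := h1.mk m with hg
  have hs : MeasurableSet {a | g a Set.univ = 1} :=
    (Measure.measurable_coe MeasurableSet.univ |>.comp h1.measurable_mk) (measurableSet_singleton 1)
  refine ⟨⟨fun a => if a ∈ {a | g a Set.univ = 1} then g a else m a₀,
    Measurable.ite hs h1.measurable_mk measurable_const⟩, ⟨fun a => ?_⟩, ?_⟩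
  · change IsProbabilityMeasure (if a ∈ {a | g a Set.univ = 1} then g a else m a₀)
    split_ifs with h
    · exact ⟨h⟩
    · exact hp _
  · filter_upwards [h1.ae_eq_mk] with a ha
    change m a = if a ∈ {a | g a Set.univ = 1} then g a else m a₀
    rw [if_pos, ha]
    change g a Set.univ = 1
    rw [hg, ← ha]
    exact (hp a).measure_univ

theorem UM.lintegral {m : α → Measure β} (hm : UM m) (hp : ∀ a, IsProbabilityMeasure (m a))
    {f : β → ℝ≥0∞} (hf : UM f) : UM fun a => ∫⁻ b, f b ∂(m a) := by
  intro μ hμ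
  have h1 := hm μ hμ
  have h2 : IsFiniteMeasure (μ.bind m) := by
    refine ⟨?_⟩
    rw [Measure.bind_apply MeasurableSet.univ h1]
    simp
  have h3 := hf.aemeasurable_of_finite (μ.bind m)
  refine (((Measure.measurable_lintegral h3.measurable_mk).comp_aemeasurable h1)).congr ?_
  filter_upwards [Measure.ae_ae_of_ae_bind h1 h3.ae_eq_mk] with a ha
  exact (lintegral_congr_ae ha).symm

theorem UM.map_prodMk {m : α → Measure β} (hm : UM m) (hp : ∀ a, IsProbabilityMeasure (m a)) :
    UM fun a => (m a).map (Prod.mk a) := by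
  intro μ hμ
  obtain ⟨κ, hκ, h⟩ := hm.exists_markovKernel hp μ
  refine ((Kernel.id ×ₖ κ).measurable.aemeasurable (μ := μ)).congr ?_
  filter_upwards [h] with a ha
  rw [Kernel.prod_apply, Kernel.id_apply, Measure.dirac_prod, ha]

/-- The joint law of `h ∼ ν` and `a ∼ m h`. -/
def adjoin (ν : Measure α) (m : α → Measure β) : Measure (α × β) :=
  ν.bind fun h => (m h).map (Prod.mk h)

theorem adjoin_congr {ν : Measure α} {m m' : α → Measure β} (h : ∀ᵐ a ∂ν, m a = m' a) :
    adjoin ν m = adjoin ν m' := by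
  refine Measure.bind_congr_right ?_
  filter_upwards [h] with a ha
  rw [ha]

theorem adjoin_kernel (ν : Measure α) [SFinite ν] (κ : Kernel α β) [IsSFiniteKernel κ] :
    adjoin ν κ = ν ⊗ₘ κ := by
  have : (fun h => (κ h).map (Prod.mk h)) = (Kernel.id ×ₖ κ) := by
    ext1 a
    rw [Kernel.prod_apply, Kernel.id_apply, Measure.dirac_prod]
  rw [adjoin, this, Measure.compProd_eq_comp_prod]

theorem isProbabilityMeasure_adjoin (ν : Measure α) [IsProbabilityMeasure ν] {m : α → Measure β}
    (hm : UM m) (hp : ∀ a, IsProbabilityMeasure (m a)) : IsProbabilityMeasure (adjoin ν m) := by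
  obtain ⟨κ, hκ, h⟩ := hm.exists_markovKernel hp ν
  rw [adjoin_congr h, adjoin_kernel]
  infer_instance

end Adjoin

section HistoryLaws

variable {X A : Type*} [MeasurableSpace X] [MeasurableSpace A]

/-- The history of a trajectory up to time `n`. -/
def histOf (n : ℕ) (ω : Traj X A) : Hist X A n := (fun i : Fin n => ω i.val, (ω n).1)

theorem measurable_histOf (n : ℕ) : Measurable (histOf n : Traj X A → Hist X A n) :=
  (measurable_pi_lambda _ fun _ => measurable_pi_apply _).prodMk (measurable_pi_apply n).fst

theorem measurable_histOf_action (n : ℕ) :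
    Measurable fun ω : Traj X A => (histOf n ω, (ω n).2) :=
  (measurable_histOf n).prodMk (measurable_pi_apply n).snd

theorem measurable_snoc (n : ℕ) : Measurable fun p : Hist X A n × A =>
    (Fin.snoc p.1.1 (p.1.2, p.2) : Fin (n + 1) → X × A) := by
  refine measurable_pi_lambda _ fun i => ?_
  induction i using Fin.lastCases with
  | last => simpa using measurable_fst.snd.prodMk measurable_snd
  | cast i => simpa [Function.comp_def] using (measurable_pi_apply i).comp (measurable_fst.fst (f := fun p : Hist X A n × A => p.1))

/-- One transition of the history process. -/
def stepKernel (q : Kernel (X × A) X) (n : ℕ) : Kernel (Hist X A n × A) (Hist X A (n + 1)) :=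
  (Kernel.deterministic (fun p => (Fin.snoc p.1.1 (p.1.2, p.2) : Fin (n + 1) → X × A))
    (measurable_snoc n)) ×ₖ
  (q.comap (fun p => (p.1.2, p.2)) (measurable_fst.snd.prodMk measurable_snd))

instance (q : Kernel (X × A) X) [IsMarkovKernel q] (n : ℕ) : IsMarkovKernel (stepKernel q n) := by
  unfold stepKernel; infer_instance

variable (q : Kernel (X × A) X) [IsMarkovKernel q]

theorem stepKernel_apply (n : ℕ) (p : Hist X A n × A) : stepKernel q n p =
    (q (p.1.2, p.2)).map (Prod.mk (Fin.snoc p.1.1 (p.1.2, p.2) : Fin (n + 1) → X × A)) := by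
  rw [stepKernel, Kernel.prod_apply, Kernel.deterministic_apply, Kernel.comap_apply,
    Measure.dirac_prod]

/-- Forget the last state of a history. -/
def dropLast (n : ℕ) (h : Hist X A (n + 1)) : Hist X A n × A :=
  ((Fin.init h.1, (h.1 (Fin.last n)).1), (h.1 (Fin.last n)).2)

theorem measurable_dropLast (n : ℕ) : Measurable (dropLast n : Hist X A (n + 1) → Hist X A n × A) := by
  refine Measurable.prodMk (Measurable.prodMk ?_ ?_) ?_
  · exact measurable_pi_lambda _ fun i => (measurable_pi_apply _).comp measurable_fst
  · exact ((measurable_pi_apply _).comp measurable_fst).fst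
  · exact ((measurable_pi_apply _).comp measurable_fst).snd

theorem map_dropLast_bind_stepKernel (n : ℕ) (ρ : Measure (Hist X A n × A)) :
    (ρ.bind (stepKernel q n)).map (dropLast n) = ρ := by
  rw [← Measure.bind_dirac_eq_map _ (measurable_dropLast n),
    Measure.bind_bind (g := fun x => Measure.dirac (dropLast n x))
      (stepKernel q n).measurable.aemeasurable
      (Measure.measurable_dirac.comp (measurable_dropLast n)).aemeasurable]
  conv_rhs => rw [← Measure.bind_dirac (m := ρ)]
  congr 1
  ext1 p
  rw [Measure.bind_dirac_eq_map _ (measurable_dropLast n), stepKernel_apply,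
    Measure.map_map (measurable_dropLast n) measurable_prodMk_left]
  have : dropLast n ∘ Prod.mk (Fin.snoc p.1.1 (p.1.2, p.2) : Fin (n + 1) → X × A) = fun _ => p := by
    ext1 y
    simp [dropLast]
  rw [this, Measure.map_const, measure_univ, one_smul]

/-- The law of the history at time `n`. -/
def histLaw (p0 : Measure X) (m : ∀ n : ℕ, Hist X A n → Measure A) : ∀ n : ℕ, Measure (Hist X A n)
  | 0 => p0.map fun x => (Fin.elim0, x)
  | n + 1 => (adjoin (histLaw p0 m n) (m n)).bind (stepKernel q n)

variable {q} {Acts : X → Set A}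

theorem Policy.um [MeasurableSpace.CountablyGenerated A] (π : Policy Acts) (n : ℕ) :
    UM (π.μ n) :=
  um_measure (π.isProb n) fun B hB => (π.umeas n B hB).um

theorem Policy.isProbabilityMeasure_histLaw [MeasurableSpace.CountablyGenerated A]
    (π : Policy Acts) (p0 : Measure X) [IsProbabilityMeasure p0] (n : ℕ) :
    IsProbabilityMeasure (histLaw q p0 π.μ n) := by
  induction n with
  | zero => exact Measure.isProbabilityMeasure_map (by fun_prop)
  | succ n ih =>
    have := isProbabilityMeasure_adjoin (histLaw q p0 π.μ n) (π.um n) (π.isProb n)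
    change IsProbabilityMeasure ((adjoin (histLaw q p0 π.μ n) (π.μ n)).bind (stepKernel q n))
    infer_instance

theorem Policy.histInt_eq_lintegral [MeasurableSpace.CountablyGenerated A]
    (π : Policy Acts) (p0 : Measure X) [IsProbabilityMeasure p0] (n : ℕ) :
    ∀ f : Hist X A n → ℝ≥0∞, UM f → histInt p0 q π.μ n f = ∫⁻ h, f h ∂(histLaw q p0 π.μ n) := by
  induction n with
  | zero =>
    intro f hf
    have := π.isProbabilityMeasure_histLaw (q := q) p0 0
    exact (lintegral_map' (hf _ this) (by fun_prop)).symm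
  | succ n ih =>
    intro f hf
    have hprob := π.isProbabilityMeasure_histLaw (q := q) p0 n
    have hm := (π.um n).map_prodMk (π.isProb n)
    have hmp : ∀ h, IsProbabilityMeasure ((π.μ n h).map (Prod.mk h)) := fun h => by
      have := π.isProb n h
      exact Measure.isProbabilityMeasure_map (by fun_prop)
    have hk : UM fun h => ((π.μ n h).map (Prod.mk h)).bind (stepKernel q n) :=
      (Measure.measurable_bind' (stepKernel q n).measurable).comp_um hm
    have hkp : ∀ h, IsProbabilityMeasure (((π.μ n h).map (Prod.mk h)).bind (stepKernel q n)) :=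
      fun h => inferInstance
    have key : ∀ h : Hist X A n, (∫⁻ a, ∫⁻ y, f (Fin.snoc h.1 (h.2, a), y) ∂(q (h.2, a)) ∂(π.μ n h))
        = ∫⁻ v, f v ∂(((π.μ n h).map (Prod.mk h)).bind (stepKernel q n)) := by
      intro h
      have hF : UM fun p : Hist X A n × A => ∫⁻ v, f v ∂(stepKernel q n p) :=
        UM.lintegral (.of_measurable (stepKernel q n).measurable) (fun _ => inferInstance) hf
      rw [Measure.lintegral_bind (stepKernel q n).measurable.aemeasurable (hf _ (hkp h)),
        lintegral_map' (hF _ (hmp h)) (by fun_prop)]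
      refine lintegral_congr fun a => ?_
      rw [stepKernel_apply, lintegral_map' _ (by fun_prop)]
      refine hf _ (Measure.isProbabilityMeasure_map (by fun_prop))
    change histInt p0 q π.μ n _ = _
    simp_rw [key]
    rw [ih _ (hk.lintegral hkp hf)]
    have e : histLaw q p0 π.μ (n + 1) = (histLaw q p0 π.μ n).bind
        fun h => ((π.μ n h).map (Prod.mk h)).bind (stepKernel q n) :=
      Measure.bind_bind (hm _ hprob) (stepKernel q n).measurable.aemeasurable
    have hprob' := π.isProbabilityMeasure_histLaw (q := q) p0 (n + 1)
    rw [e] at hprob' ⊢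
    rw [Measure.lintegral_bind (hk _ hprob) (hf _ hprob')]

theorem induces_iff_histLaw [MeasurableSpace.CountablyGenerated A]
    {π : Policy Acts} {p0 : Measure X} [IsProbabilityMeasure p0] {P : Measure (Traj X A)} :
    Induces q π p0 P ↔ ∀ n, P.map (histOf n) = histLaw q p0 π.μ n := by
  have h : ∀ n (B : Set (Hist X A n)), MeasurableSet B →
      histInt p0 q π.μ n (B.indicator fun _ => 1) = histLaw q p0 π.μ n B := fun n B hB => by
    rw [π.histInt_eq_lintegral p0 n _ (.of_measurable (measurable_const.indicator hB)),
      lintegral_indicator hB, setLIntegral_one]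
  constructor
  · intro hI n
    ext B hB
    rw [Measure.map_apply (measurable_histOf n) hB, ← h n B hB, ← hI n B hB]
    rfl
  · intro hI n B hB
    rw [h n B hB, ← hI n, Measure.map_apply (measurable_histOf n) hB]
    rfl

theorem induces_iff [MeasurableSpace.CountablyGenerated A]
    {π : Policy Acts} {p0 : Measure X} [IsProbabilityMeasure p0] {P : Measure (Traj X A)} :
    Induces q π p0 P ↔ P.map (fun ω => (ω 0).1) = p0 ∧ ∀ n,
      P.map (fun ω => (histOf n ω, (ω n).2)) = adjoin (P.map (histOf n)) (π.μ n) ∧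
      P.map (histOf (n + 1)) = (P.map fun ω => (histOf n ω, (ω n).2)).bind (stepKernel q n) := by
  have hm0 : Measurable fun x : X => ((Fin.elim0, x) : Hist X A 0) := by fun_prop
  have hw0 : Measurable fun ω : Traj X A => (ω 0).1 := by fun_prop
  have h0 : P.map (histOf 0) = histLaw q p0 π.μ 0 ↔ P.map (fun ω => (ω 0).1) = p0 := by
    have e : (histOf 0 : Traj X A → _) = (fun x : X => ((Fin.elim0, x) : Hist X A 0)) ∘
        fun ω => (ω 0).1 := by
      ext1 ω
      exact Prod.ext (Subsingleton.elim _ _) rfl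
    rw [e, ← Measure.map_map hm0 hw0]
    constructor
    · intro h
      have := congrArg (Measure.map Prod.snd) h
      change _ = Measure.map Prod.snd (Measure.map _ _) at this
      rw [Measure.map_map measurable_snd hm0, Measure.map_map measurable_snd hm0] at this
      simpa [Function.comp_def] using this
    · intro h
      rw [h]; rfl
  rw [induces_iff_histLaw]
  constructor
  · intro h
    refine ⟨h0.1 (h 0), fun n => ?_⟩
    have h1 : P.map (fun ω => (histOf n ω, (ω n).2)) = adjoin (P.map (histOf n)) (π.μ n) := by
      have : (fun ω : Traj X A => (histOf n ω, (ω n).2)) = dropLast n ∘ histOf (n + 1) := rfl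
      rw [this, ← Measure.map_map (measurable_dropLast n) (measurable_histOf _), h (n + 1), h n]
      exact map_dropLast_bind_stepKernel q n _
    refine ⟨h1, ?_⟩
    rw [h1, h (n + 1), h n]
    rfl
  · rintro ⟨h1, h2⟩ n
    induction n with
    | zero => exact h0.2 h1
    | succ n ih => rw [(h2 n).2, (h2 n).1, ih]; rfl

end HistoryLaws

section Disintegration

theorem map_bind_eq {α β γ : Type*} [MeasurableSpace α] [MeasurableSpace β] [MeasurableSpace γ]
    {ν : Measure α} {k : α → Measure β} (hk : AEMeasurable k ν) {f : β → γ} (hf : Measurable f) :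
    (ν.bind k).map f = ν.bind fun a => (k a).map f := by
  rw [Measure.bind, Measure.bind, ← Measure.join_map_map hf,
    AEMeasurable.map_map_of_aemeasurable (Measure.measurable_map f hf).aemeasurable hk]
  rfl

theorem bind_map_eq {α β γ : Type*} [MeasurableSpace α] [MeasurableSpace β] [MeasurableSpace γ]
    {ν : Measure α} {f : α → β} (hf : Measurable f) {k : β → Measure γ}
    (hk : AEMeasurable k (ν.map f)) : (ν.map f).bind k = ν.bind fun a => k (f a) := by
  rw [Measure.bind, Measure.bind, AEMeasurable.map_map_of_aemeasurable hk hf.aemeasurable]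
  rfl

theorem map_adjoin {α β I : Type*} [MeasurableSpace α] [MeasurableSpace β] [MeasurableSpace I]
    {ν : Measure α} [IsProbabilityMeasure ν] {f : α → I} (hf : Measurable f) {m : I → Measure β}
    (hm : UM m) (hp : ∀ i, IsProbabilityMeasure (m i)) :
    (adjoin ν fun a => m (f a)).map (fun p => (f p.1, p.2)) = adjoin (ν.map f) m := by
  have hf' : Measurable fun p : α × β => (f p.1, p.2) := by fun_prop
  have := Measure.isProbabilityMeasure_map (μ := ν) hf.aemeasurable
  rw [adjoin, adjoin, map_bind_eq ((hm.comp_measurable hf).map_prodMk (fun a => hp _) ν ‹_›) hf',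
    bind_map_eq hf (hm.map_prodMk hp _ this)]
  congr 1
  ext1 a
  rw [Measure.map_map hf' (by fun_prop)]
  rfl

theorem fst_adjoin {α β : Type*} [MeasurableSpace α] [MeasurableSpace β]
    {ν : Measure α} [IsProbabilityMeasure ν] {m : α → Measure β}
    (hm : UM m) (hp : ∀ i, IsProbabilityMeasure (m i)) : (adjoin ν m).fst = ν := by
  obtain ⟨κ, hκ, h⟩ := hm.exists_markovKernel hp ν
  rw [adjoin_congr h, adjoin_kernel, Measure.fst_compProd]

variable {T I A : Type*} [MeasurableSpace T] [MeasurableSpace I] [MeasurableSpace A]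
  [StandardBorelSpace T] [StandardBorelSpace I] [StandardBorelSpace A] [Nonempty A]

theorem exists_common_disintegration (L : ℕ → Kernel T (I × A)) (hL : ∀ n, IsMarkovKernel (L n)) :
    ∃ κ : Kernel (T × I) A, IsMarkovKernel κ ∧ ∀ (t : T) (m : I → Measure A), UM m →
      (∀ i, IsProbabilityMeasure (m i)) → (∀ n, L n t = adjoin (L n t).fst m) →
      ∀ n, ∀ᵐ i ∂(L n t).fst, κ (t, i) = m i := by
  let γ : Measure ℕ := Measure.count.toFinite
  let L' : Kernel (T × ℕ) (I × A) :=
    ⟨fun p => L p.2 p.1, measurable_from_prod_countable_left fun n => (L n).measurable⟩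
  have hL' : IsMarkovKernel L' := ⟨fun p => (hL p.2).isProbabilityMeasure p.1⟩
  let M : Kernel T (I × A) := L' ∘ₖ (Kernel.id ×ₖ Kernel.const T γ)
  have hM : ∀ t, M t = γ.bind fun n => L n t := by
    intro t
    rw [Kernel.comp_apply, Kernel.prod_apply, Kernel.id_apply, Kernel.const_apply,
      Measure.dirac_prod, bind_map_eq (by fun_prop) L'.measurable.aemeasurable]
    rfl
  have hac : ∀ t n, L n t ≪ M t := by
    intro t n
    refine Measure.AbsolutelyContinuous.mk fun s hs h => ?_
    rw [hM, Measure.bind_apply hs (measurable_of_countable _).aemeasurable,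
      lintegral_eq_zero_iff (measurable_of_countable _)] at h
    have h1 : ∀ᵐ n ∂(Measure.count : Measure ℕ), L n t s = 0 := by
      rw [← ae_toFinite]; exact h
    rw [Measure.ae_count_iff] at h1
    exact h1 n
  refine ⟨M.condKernel, inferInstance, fun t m hm hp h n => ?_⟩
  obtain ⟨m', hm', hmm⟩ := hm.exists_markovKernel hp (M t).fst
  have hfst : ∀ n, (L n t).fst ≪ (M t).fst := fun n => (hac t n).map measurable_fst
  have key : M t = (M t).fst ⊗ₘ m' := by
    have h2 : ∀ ν : Measure (I × A), IsFiniteMeasure ν → ν.fst ⊗ₘ m' =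
        ν.bind fun p => (m' p.1).map (Prod.mk p.1) := by
      intro ν hν
      have hk : Measurable fun i => (m' i).map (Prod.mk i) := by
        convert (Kernel.id ×ₖ m').measurable using 2 with i
        rw [Kernel.prod_apply, Kernel.id_apply, Measure.dirac_prod]
      rw [← adjoin_kernel, adjoin, Measure.fst, bind_map_eq measurable_fst hk.aemeasurable]
    have hk : Measurable fun p : I × A => (m' p.1).map (Prod.mk p.1) := by
      have : Measurable fun i => (m' i).map (Prod.mk i) := by
        convert (Kernel.id ×ₖ m').measurable using 2 with i
        rw [Kernel.prod_apply, Kernel.id_apply, Measure.dirac_prod]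
      exact this.comp measurable_fst
    rw [h2 _ inferInstance]
    conv_lhs => rw [hM]
    conv_rhs => rw [hM]
    rw [Measure.bind_bind (measurable_of_countable _).aemeasurable hk.aemeasurable]
    congr 1
    ext1 n
    rw [← h2 _ inferInstance, ← adjoin_kernel]
    conv_lhs => rw [h n]
    refine adjoin_congr ((hfst n).ae_le hmm)
  have h3 := Kernel.condKernel_apply_eq_condKernel M t
  rw [Kernel.fst_apply] at h3
  have h4 := eq_condKernel_of_measure_eq_compProd m' key
  have h5 : ∀ᵐ i ∂(M t).fst, M.condKernel (t, i) = m i := by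
    filter_upwards [h3, h4, hmm] with i a b c
    rw [a, ← b, c]
  exact (hfst n).ae_le h5

end Disintegration

section PolicyClasses

/-- The information available to the decision maker: a statistic of the history from which the
initial and the current state can be recovered. -/
structure Info (X A I : Type*) [MeasurableSpace X] [MeasurableSpace A] [MeasurableSpace I] where
  stat : ∀ n, Hist X A n → I
  measurable_stat : ∀ n, Measurable (stat n)
  first : I → X
  measurable_first : Measurable first
  first_stat : ∀ n h, first (stat n h) = firstState h
  last : I → X
  measurable_last : Measurable last
  last_stat : ∀ n h, last (stat n h) = h.2

variable {X A I T : Type*} [TopologicalSpace X] [PolishSpace X] [MeasurableSpace X] [BorelSpace X]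
  [TopologicalSpace A] [PolishSpace A] [MeasurableSpace A] [BorelSpace A]
  [TopologicalSpace I] [PolishSpace I] [MeasurableSpace I] [BorelSpace I]
  [TopologicalSpace T] [PolishSpace T] [MeasurableSpace T] [BorelSpace T]

/-- Policies that depend on the history only through the given information, and that are
nonrandomized if `nr` holds. -/
def Info.Adapted (F : Info X A I) (nr : Prop) {Acts : X → Set A} (π : Policy Acts) : Prop :=
  (∃ m : I → Measure A, (∀ i, IsProbabilityMeasure (m i)) ∧ UM m ∧
    ∀ n h, π.μ n h = m (F.stat n h)) ∧ (nr → π.Nonrandomized)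

/-- The joint law of the history and the action at time `n`. -/
def jointK (K : Kernel T (Traj X A)) (n : ℕ) : Kernel T (Hist X A n × A) :=
  K.map fun ω => (histOf n ω, (ω n).2)

/-- The law of the history at time `n`. -/
def histK (K : Kernel T (Traj X A)) (n : ℕ) : Kernel T (Hist X A n) := K.map (histOf n)

instance (K : Kernel T (Traj X A)) [IsMarkovKernel K] (n : ℕ) : IsMarkovKernel (jointK K n) :=
  Kernel.IsMarkovKernel.map _ (measurable_histOf_action n)

instance (K : Kernel T (Traj X A)) [IsMarkovKernel K] (n : ℕ) : IsMarkovKernel (histK K n) :=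
  Kernel.IsMarkovKernel.map _ (measurable_histOf n)

theorem jointK_apply (K : Kernel T (Traj X A)) (n : ℕ) (t : T) :
    jointK K n t = (K t).map fun ω => (histOf n ω, (ω n).2) :=
  Kernel.map_apply _ (measurable_histOf_action n) _

theorem histK_apply (K : Kernel T (Traj X A)) (n : ℕ) (t : T) :
    histK K n t = (K t).map (histOf n) :=
  Kernel.map_apply _ (measurable_histOf n) _

theorem measurable_firstState (n : ℕ) : Measurable (firstState : Hist X A n → X) := by
  cases n with
  | zero => exact measurable_snd
  | succ n => exact ((measurable_pi_apply _).comp measurable_fst).fst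

theorem firstState_histOf (n : ℕ) (ω : Traj X A) : firstState (histOf n ω) = (ω 0).1 := by
  cases n <;> rfl

/-- The parameters at which a decision kernel is admissible. -/
def Info.good (F : Info X A I) (nr : Prop) (Acts : X → Set A) (κ : Kernel (T × I) A) :
    Set (T × I) :=
  {p | 1 ≤ κ p {a | a ∈ Acts (F.last p.2)} ∧ (nr → ∃ a, κ p = Measure.dirac a)}

theorem Info.analyticSet_good (F : Info X A I) (nr : Prop) {Acts : X → Set A}
    (hΓ : AnalyticSet {xa : X × A | xa.2 ∈ Acts xa.1}) (κ : Kernel (T × I) A) [IsMarkovKernel κ] :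
    AnalyticSet (F.good nr Acts κ) := by
  have h1 : AnalyticSet {p : T × I | 1 ≤ κ p {a | a ∈ Acts (F.last p.2)}} :=
    analyticSet_le_kernel_section κ (E := {z : (T × I) × A | z.2 ∈ Acts (F.last z.1.2)})
      (hΓ.preimage_measurable (f := fun z : (T × I) × A => (F.last z.1.2, z.2))
        ((F.measurable_last.comp measurable_fst.snd).prodMk measurable_snd)) 1
  refine h1.inter ?_
  by_cases hnr : nr
  · have h2 : AnalyticSet {p : T × I | ∃ a, (p, a) ∈ {z : (T × I) × A | κ z.1 = Measure.dirac z.2}} :=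
      (AnalyticSet.of_measurableSet (measurableSet_kernel_eq (κ.measurable.comp measurable_fst)
        (Measure.measurable_dirac.comp measurable_snd)
        fun z => inferInstanceAs (IsFiniteMeasure (κ z.1)))).exists
    refine (congrArg _ ?_).mp h2
    ext p
    exact ⟨fun h _ => h, fun h => h hnr⟩
  · refine (congrArg _ ?_).mp (analyticSet_univ (Y := T × I))
    ext p
    exact ⟨fun _ h => absurd h hnr, fun _ => trivial⟩

/-- The kernel on the history space corresponding to a decision kernel. -/
def Info.lift (F : Info X A I) (κ : Kernel (T × I) A) (n : ℕ) : Kernel (T × Hist X A n) A :=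
  κ.comap (fun p => (p.1, F.stat n p.2))
    (measurable_fst.prodMk ((F.measurable_stat n).comp measurable_snd))

instance (F : Info X A I) (κ : Kernel (T × I) A) [IsMarkovKernel κ] (n : ℕ) :
    IsMarkovKernel (F.lift κ n) := by unfold Info.lift; infer_instance

/-- The pairs `(x, t)` for which `K t` is the law of the process started at `x` under the decision
kernel `κ`, which is moreover admissible along the process. -/
def Info.feasible (F : Info X A I) (nr : Prop) (q : Kernel (X × A) X) (Acts : X → Set A)
    (K : Kernel T (Traj X A)) (κ : Kernel (T × I) A) : Set (X × T) :=
  {z | (K z.2).map (fun ω => (ω 0).1) = Measure.dirac z.1 ∧ ∀ n,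
    jointK K n z.2 = (histK K n ⊗ₖ F.lift κ n) z.2 ∧
    histK K (n + 1) z.2 = (stepKernel q n ∘ₖ jointK K n) z.2 ∧
    1 ≤ histK K n z.2 {h | (z.2, F.stat n h) ∈ F.good nr Acts κ}}

variable {q : Kernel (X × A) X} [IsMarkovKernel q] {Acts : X → Set A}
  {K : Kernel T (Traj X A)} [IsMarkovKernel K]

theorem Info.analyticSet_feasible (F : Info X A I) (nr : Prop)
    (hΓ : AnalyticSet {xa : X × A | xa.2 ∈ Acts xa.1}) (κ : Kernel (T × I) A) [IsMarkovKernel κ] :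
    AnalyticSet (F.feasible nr q Acts K κ) := by
  have hw0 : Measurable fun ω : Traj X A => (ω 0).1 := by fun_prop
  have h0 : AnalyticSet {z : X × T | (K z.2).map (fun ω => (ω 0).1) = Measure.dirac z.1} := by
    refine .of_measurableSet (measurableSet_kernel_eq ?_ (Measure.measurable_dirac.comp measurable_fst)
      fun z => Measure.isFiniteMeasure_map _ _)
    exact (Measure.measurable_map _ hw0).comp (K.measurable.comp measurable_snd)
  have h1 : ∀ n, AnalyticSet {z : X × T | jointK K n z.2 = (histK K n ⊗ₖ F.lift κ n) z.2} := fun n =>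
    .of_measurableSet (measurableSet_kernel_eq ((jointK K n).measurable.comp measurable_snd)
      ((histK K n ⊗ₖ F.lift κ n).measurable.comp measurable_snd) fun z => inferInstance)
  have h2 : ∀ n, AnalyticSet
      {z : X × T | histK K (n + 1) z.2 = (stepKernel q n ∘ₖ jointK K n) z.2} := fun n =>
    .of_measurableSet (measurableSet_kernel_eq ((histK K (n + 1)).measurable.comp measurable_snd)
      ((stepKernel q n ∘ₖ jointK K n).measurable.comp measurable_snd) fun z => inferInstance)
  have h3 : ∀ n, AnalyticSet {z : X × T |
      1 ≤ histK K n z.2 {h | (z.2, F.stat n h) ∈ F.good nr Acts κ}} := fun n =>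
    (analyticSet_le_kernel_section (histK K n)
      (E := {p : T × Hist X A n | (p.1, F.stat n p.2) ∈ F.good nr Acts κ})
      ((F.analyticSet_good nr hΓ κ).preimage_measurable
        (measurable_fst.prodMk ((F.measurable_stat n).comp measurable_snd))) 1).preimage_measurable
      measurable_snd
  have h4 := h0.inter (AnalyticSet.iInter fun n => (h1 n).inter ((h2 n).inter (h3 n)))
  refine (congrArg _ ?_).mp h4
  ext z
  simp only [Info.feasible, Set.mem_inter_iff, Set.mem_iInter, Set.mem_ofPred_eq]

theorem compProd_lift_apply (F : Info X A I) (κ : Kernel (T × I) A) [IsMarkovKernel κ] (n : ℕ)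
    (t : T) : (histK K n ⊗ₖ F.lift κ n) t = adjoin (histK K n t) fun h => κ (t, F.stat n h) := by
  rw [Kernel.compProd_apply_eq_compProd_sectR, ← adjoin_kernel]
  rfl

theorem Info.mem_feasible (F : Info X A I) {nr : Prop} {κ : Kernel (T × I) A} [IsMarkovKernel κ]
    (hκ : ∀ (t : T) (m : I → Measure A), UM m → (∀ i, IsProbabilityMeasure (m i)) →
      (∀ n, (jointK K n t).map (fun p => (F.stat n p.1, p.2)) =
        adjoin ((histK K n t).map (F.stat n)) m) →
      ∀ n, ∀ᵐ i ∂(histK K n t).map (F.stat n), κ (t, i) = m i)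
    {π : Policy Acts} (hπ : F.Adapted nr π) {x : X} {t : T}
    (hI : Induces q π (Measure.dirac x) (K t)) : (x, t) ∈ F.feasible nr q Acts K κ := by
  obtain ⟨⟨m, hmp, hm, hπm⟩, hnr⟩ := hπ
  obtain ⟨h0, h1⟩ := induces_iff.1 hI
  simp_rw [← jointK_apply, ← histK_apply] at h1
  have hπm' : ∀ n, π.μ n = fun h => m (F.stat n h) := fun n => funext (hπm n)
  have hae : ∀ n, ∀ᵐ h ∂(histK K n t), κ (t, F.stat n h) = π.μ n h := by
    intro n
    have h2 := hκ t m hm hmp (fun n => by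
      rw [(h1 n).1, hπm', map_adjoin (F.measurable_stat n) hm hmp]) n
    filter_upwards [ae_of_ae_map (F.measurable_stat n).aemeasurable h2] with h hh
    rw [hh, hπm]
  refine ⟨h0, fun n => ⟨?_, ?_, ?_⟩⟩
  · rw [compProd_lift_apply]
    exact (h1 n).1.trans (adjoin_congr (hae n)).symm
  · rw [Kernel.comp_apply]
    exact (h1 n).2
  · rw [← measure_univ (μ := histK K n t)]
    refine measure_mono_ae ?_
    filter_upwards [hae n] with h hh _
    refine ⟨?_, fun hn => ?_⟩
    · change 1 ≤ κ (t, F.stat n h) (Acts (F.last (F.stat n h)))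
      rw [F.last_stat, hh, π.feasible]
    · obtain ⟨a, ha⟩ := hnr hn n h
      exact ⟨a, hh.trans ha⟩

theorem Info.exists_policy (F : Info X A I) {nr : Prop} {κ : Kernel (T × I) A} [IsMarkovKernel κ]
    (hΓ : AnalyticSet {xa : X × A | xa.2 ∈ Acts xa.1})
    {sel : X → A} (hsel : UM sel) (hsel' : ∀ x, sel x ∈ Acts x)
    {τ : X → T} (hτ : UM τ) (hτ' : ∀ x, (x, τ x) ∈ F.feasible nr q Acts K κ) :
    ∃ π : Policy Acts, F.Adapted nr π ∧ ∀ x, Induces q π (Measure.dirac x) (K (τ x)) := by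
  classical
  have hgood := F.analyticSet_good nr hΓ κ
  have hθ : UM fun i => (τ (F.first i), i) :=
    (hτ.comp_measurable F.measurable_first).prodMk (.of_measurable measurable_id)
  let s : Set I := (fun i => (τ (F.first i), i)) ⁻¹' F.good nr Acts κ
  let m : I → Measure A := fun i =>
    if i ∈ s then κ (τ (F.first i), i) else Measure.dirac (sel (F.last i))
  have hm : UM m := UM.ite (hgood.universallyMeasurableSet.preimage hθ)
    (κ.measurable.comp_um hθ)
    (Measure.measurable_dirac.comp_um (hsel.comp_measurable F.measurable_last))
  have hmp : ∀ i, IsProbabilityMeasure (m i) := by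
    intro i
    simp only [m]
    split_ifs <;> infer_instance
  let π : Policy Acts :=
    { μ := fun n h => m (F.stat n h)
      isProb := fun n h => hmp _
      umeas := fun n B hB =>
        ((hm.comp_measurable (F.measurable_stat n)).measure_apply hB).universallyMeasurable
      feasible := by
        intro n h
        by_cases hs : F.stat n h ∈ s
        · simp only [m, if_pos hs]
          refine le_antisymm prob_le_one ?_
          have h1 := hs.1
          change 1 ≤ κ _ (Acts (F.last (F.stat n h))) at h1
          rwa [F.last_stat] at h1
        · simp only [m, if_neg hs, F.last_stat]
          exact Measure.dirac_apply_of_mem (hsel' _) }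
  refine ⟨π, ⟨⟨m, hmp, hm, fun n h => rfl⟩, fun hn n h => ?_⟩, fun x => ?_⟩
  · by_cases hs : F.stat n h ∈ s
    · obtain ⟨a, ha⟩ := hs.2 hn
      exact ⟨a, (if_pos hs).trans ha⟩
    · exact ⟨_, if_neg hs⟩
  · obtain ⟨h0, h1⟩ := hτ' x
    refine induces_iff.2 ⟨h0, fun n => ?_⟩
    obtain ⟨ha, hb, hc⟩ := h1 n
    rw [← jointK_apply, ← histK_apply, ← histK_apply]
    refine ⟨?_, by rw [hb, Kernel.comp_apply]⟩
    rw [ha, compProd_lift_apply]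
    refine adjoin_congr ?_
    have hfirst : ∀ᵐ h ∂(histK K n (τ x)), firstState h = x := by
      have e1 : ∀ᵐ y ∂(K (τ x)).map (fun ω => (ω 0).1), y = x := by
        rw [h0, ae_dirac_eq]; exact rfl
      have hw0 : Measurable fun ω : Traj X A => (ω 0).1 := by fun_prop
      have e2 := ae_of_ae_map hw0.aemeasurable e1
      rw [histK_apply, ae_map_iff (p := fun h => firstState h = x)
        (measurable_histOf n).aemeasurable
        (measurable_firstState n (measurableSet_singleton x))]
      filter_upwards [e2] with ω hω
      rw [firstState_histOf, hω]
    have hadm : ∀ᵐ h ∂(histK K n (τ x)), (τ x, F.stat n h) ∈ F.good nr Acts κ := by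
      have e1 : UniversallyMeasurableSet {h | (τ x, F.stat n h) ∈ F.good nr Acts κ} :=
        hgood.universallyMeasurableSet.preimage
          (.of_measurable (measurable_const.prodMk (F.measurable_stat n)))
      exact (mem_ae_iff_prob_eq_one₀ (e1 _ inferInstance)).2 (le_antisymm prob_le_one hc)
    filter_upwards [hfirst, hadm] with h h2 h3
    change _ = m (F.stat n h)
    have h4 : F.first (F.stat n h) = x := (F.first_stat n h).trans h2
    have hs : F.stat n h ∈ s := by
      change (τ (F.first (F.stat n h)), F.stat n h) ∈ F.good nr Acts κ
      rwa [h4]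
    simp only [m, if_pos hs, h4]

end PolicyClasses

section Existence

theorem map_eval_zero_trajMeasure {E : ℕ → Type*} [∀ n, MeasurableSpace (E n)]
    (μ₀ : Measure (E 0)) (κ : (n : ℕ) → Kernel (Π i : Finset.Iic n, E i) (E (n + 1)))
    [∀ n, IsMarkovKernel (κ n)] :
    (Kernel.trajMeasure μ₀ κ).map (fun ω => ω 0) = μ₀ := by
  have h1 : (Kernel.trajMeasure μ₀ κ).map (Preorder.frestrictLe (π := E) 0) =
      μ₀.map (MeasurableEquiv.piUnique (fun i : Finset.Iic 0 => E i)).symm := by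
    rw [Kernel.trajMeasure, Measure.map_comp _ _ (by fun_prop), Kernel.traj_map_frestrictLe,
      Kernel.partialTraj_self]
    exact Measure.id_comp
  have h2 : (fun ω : Π n, E n => ω 0) =
      (fun u : Π i : Finset.Iic 0, E i => u ⟨0, by simp⟩) ∘ Preorder.frestrictLe (π := E) 0 := rfl
  rw [h2, ← Measure.map_map (by fun_prop) (by fun_prop), h1]
  exact (Measure.map_map (μ := μ₀) (measurable_pi_apply _) (MeasurableEquiv.measurable _)).trans
    Measure.map_id

variable {X A : Type*} [MeasurableSpace X] [MeasurableSpace A]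
  {q : Kernel (X × A) X} [IsMarkovKernel q] {Acts : X → Set A}

/-- The history up to time `n`, with the action at time `n`, of a finite trajectory. -/
def histOfRestrict (n : ℕ) (u : Finset.Iic n → X × A) : Hist X A n × A :=
  ((fun i : Fin n => u ⟨i.val, Finset.mem_Iic.2 i.2.le⟩, (u ⟨n, Finset.mem_Iic.2 le_rfl⟩).1),
    (u ⟨n, Finset.mem_Iic.2 le_rfl⟩).2)

theorem measurable_histOfRestrict (n : ℕ) :
    Measurable (histOfRestrict n : (Finset.Iic n → X × A) → Hist X A n × A) := by
  unfold histOfRestrict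
  fun_prop

/-- Every policy induces a probability measure on the trajectories. -/
theorem Policy.exists_induces [MeasurableSpace.CountablyGenerated A] (π : Policy Acts)
    (p0 : Measure X) [IsProbabilityMeasure p0] :
    ∃ P : Measure (Traj X A), IsProbabilityMeasure P ∧ Induces q π p0 P := by
  have hN := π.isProbabilityMeasure_histLaw (q := q) p0
  choose κ hκ hκπ using fun n => (π.um n).exists_markovKernel (π.isProb n) (histLaw q p0 π.μ n)
  have hκm : ∀ n, UM (κ n) := fun n => .of_measurable (κ n).measurable
  have hκp : ∀ n h, IsProbabilityMeasure (κ n h) := fun n h => inferInstance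
  let step : ∀ n, Kernel (Hist X A n × A) (X × A) := fun n =>
    (q.comap (fun p => (p.1.2, p.2)) (measurable_fst.snd.prodMk measurable_snd)) ⊗ₖ
      ((κ (n + 1)).comap
        (fun z => ((Fin.snoc z.1.1.1 (z.1.1.2, z.1.2) : Fin (n + 1) → X × A), z.2))
        (((measurable_snoc n).comp measurable_fst).prodMk measurable_snd))
  have hstep : ∀ n p, (step n p).map (fun ya : X × A =>
      (((Fin.snoc p.1.1 (p.1.2, p.2) : Fin (n + 1) → X × A), ya.1), ya.2)) =
      adjoin (stepKernel q n p) (κ (n + 1)) := by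
    intro n p
    rw [stepKernel_apply, ← map_adjoin measurable_prodMk_left (hκm _) (hκp _)]
    congr 1
    rw [Kernel.compProd_apply_eq_compProd_sectR, ← adjoin_kernel]
    rfl
  let κ' : ∀ n, Kernel (Finset.Iic n → X × A) (X × A) := fun n =>
    (step n).comap (histOfRestrict n) (measurable_histOfRestrict n)
  have hP0 := isProbabilityMeasure_adjoin (histLaw q p0 π.μ 0) (hκm 0) (hκp 0)
  have hm0 : Measurable fun p : Hist X A 0 × A => (p.1.2, p.2) :=
    measurable_fst.snd.prodMk measurable_snd
  let μ₀ : Measure (X × A) := (adjoin (histLaw q p0 π.μ 0) (κ 0)).map fun p => (p.1.2, p.2)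
  have hμ₀ : IsProbabilityMeasure μ₀ := Measure.isProbabilityMeasure_map hm0.aemeasurable
  let P : Measure (Traj X A) := Kernel.trajMeasure (X := fun _ => X × A) μ₀ κ'
  have hP : IsProbabilityMeasure P :=
    inferInstanceAs (IsProbabilityMeasure (Kernel.trajMeasure (X := fun _ => X × A) μ₀ κ'))
  let S : ∀ n, Measure (Hist X A n × A) := fun n => P.map fun ω => (histOf n ω, (ω n).2)
  have hfst : ∀ n, (S n).map Prod.fst = P.map (histOf n) := fun n => by
    rw [Measure.map_map measurable_fst (measurable_histOf_action n)]
    rfl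
  have hS0 : S 0 = adjoin (histLaw q p0 π.μ 0) (κ 0) := by
    have h1 : P.map (fun ω => ω 0) = μ₀ := map_eval_zero_trajMeasure (E := fun _ => X × A) μ₀ κ'
    have hm : Measurable fun z : X × A => (((Fin.elim0, z.1) : Hist X A 0), z.2) := by fun_prop
    have h2 : (fun ω : Traj X A => (histOf 0 ω, (ω 0).2)) =
        (fun z : X × A => (((Fin.elim0, z.1) : Hist X A 0), z.2)) ∘ fun ω => ω 0 := by
      ext1 ω
      exact Prod.ext (Prod.ext (Subsingleton.elim _ _) rfl) rfl
    change P.map _ = _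
    rw [h2, ← Measure.map_map hm (measurable_pi_apply 0), h1, Measure.map_map hm hm0]
    convert Measure.map_id
    ext1 p
    exact Prod.ext (Prod.ext (Subsingleton.elim _ _) rfl) rfl
  have hSS : ∀ n, S (n + 1) = (S n).bind fun p => adjoin (stepKernel q n p) (κ (n + 1)) := by
    intro n
    let G : (Hist X A n × A) × (X × A) → Hist X A (n + 1) × A := fun z =>
      (((Fin.snoc z.1.1.1 (z.1.1.2, z.1.2) : Fin (n + 1) → X × A), z.2.1), z.2.2)
    have hG : Measurable G :=
      (((measurable_snoc n).comp measurable_fst).prodMk measurable_snd.fst).prodMk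
        measurable_snd.snd
    have h1 : (P.map (Preorder.frestrictLe (π := fun _ => X × A) n)) ⊗ₘ κ' n =
        P.map (fun x => (Preorder.frestrictLe (π := fun _ => X × A) n x, x (n + 1))) :=
      Kernel.map_frestrictLe_trajMeasure_compProd_eq_map_trajMeasure (X := fun _ => X × A)
    have h2 : S n = (P.map (Preorder.frestrictLe (π := fun _ => X × A) n)).map
        (histOfRestrict n) := by
      rw [Measure.map_map (measurable_histOfRestrict n) (by fun_prop)]
      rfl
    have h3 : P.map (fun x => ((histOf n x, (x n).2), x (n + 1))) = adjoin (S n) (step n) := by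
      have hp := Measure.isProbabilityMeasure_map (μ := P)
        (Preorder.measurable_frestrictLe (X := fun _ => X × A) n).aemeasurable
      rw [h2, ← map_adjoin (measurable_histOfRestrict n)
        (.of_measurable (step n).measurable) fun _ => inferInstance]
      have h4 : (adjoin (P.map (Preorder.frestrictLe (π := fun _ => X × A) n))
          fun a => step n (histOfRestrict n a)) = _ ⊗ₘ κ' n := adjoin_kernel _ (κ' n)
      rw [h4, h1, Measure.map_map (by have := measurable_histOfRestrict (X := X) (A := A) n; fun_prop) (by fun_prop)]
      rfl
    have h5 : (fun ω : Traj X A => (histOf (n + 1) ω, (ω (n + 1)).2)) =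
        G ∘ fun x => ((histOf n x, (x n).2), x (n + 1)) := by
      ext1 ω
      refine Prod.ext (Prod.ext ?_ rfl) rfl
      ext1 i
      induction i using Fin.lastCases with
      | last => simp [G, histOf]
      | cast i => simp [G, histOf]
    have hms : UM fun h : Hist X A n × A => (step n h).map (Prod.mk h) :=
      UM.map_prodMk (.of_measurable (step n).measurable) fun _ => inferInstance
    have hSn : IsProbabilityMeasure (S n) :=
      Measure.isProbabilityMeasure_map (measurable_histOf_action n).aemeasurable
    change P.map _ = _
    rw [h5, ← Measure.map_map hG ((measurable_histOf_action n).prodMk (measurable_pi_apply _)), h3,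
      adjoin, map_bind_eq (hms _ hSn) hG]
    congr 1
    ext1 p
    rw [Measure.map_map hG measurable_prodMk_left, ← hstep]
    rfl
  have hν : ∀ n, P.map (histOf (n + 1)) = (S n).bind (stepKernel q n) := by
    intro n
    have hms : Measurable fun p => adjoin (stepKernel q n p) (κ (n + 1)) := by
      simp_rw [adjoin_kernel]
      have : (fun p => stepKernel q n p ⊗ₘ κ (n + 1)) =
          (Kernel.id ×ₖ κ (n + 1)) ∘ₖ stepKernel q n := by
        ext1 p
        rw [Kernel.comp_apply, Measure.compProd_eq_comp_prod]
      rw [this]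
      exact Kernel.measurable _
    rw [← hfst, hSS, map_bind_eq hms.aemeasurable measurable_fst]
    congr 1
    ext1 p
    exact fst_adjoin (hκm _) (hκp _)
  have hS : ∀ n, S n = adjoin (P.map (histOf n)) (κ n) := by
    intro n
    cases n with
    | zero =>
      rw [← hfst, hS0]
      congr 1
      exact (fst_adjoin (hκm _) (hκp _)).symm
    | succ n =>
      have hk : Measurable fun h => (κ (n + 1) h).map (Prod.mk h) := by
        convert (Kernel.id ×ₖ κ (n + 1)).measurable using 2 with i
        rw [Kernel.prod_apply, Kernel.id_apply, Measure.dirac_prod]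
      rw [hν, hSS, adjoin, Measure.bind_bind (stepKernel q n).measurable.aemeasurable
        hk.aemeasurable]
      rfl
  refine ⟨P, hP, induces_iff_histLaw.2 fun n => ?_⟩
  induction n with
  | zero => rw [← hfst, hS0]; exact fst_adjoin (hκm _) (hκp _)
  | succ n ih => rw [hν, hS, ih, ← adjoin_congr (hκπ n)]; rfl

end Existence

theorem UM.of_forall_nat {Y β : Type*} [MeasurableSpace Y] [MeasurableSpace β] {f : ℕ × Y → β}
    (hf : ∀ n, UM fun y => f (n, y)) : UM f := by
  intro μ hμ
  have hν : IsProbabilityMeasure (μ.map Prod.snd) :=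
    Measure.isProbabilityMeasure_map measurable_snd.aemeasurable
  have h := fun n => hf n (μ.map Prod.snd) hν
  refine ⟨fun p => (h p.1).mk _ p.2, measurable_from_prod_countable_right fun n => (h n).measurable_mk, ?_⟩
  have h1 : ∀ᵐ p ∂μ, ∀ n, f (n, p.2) = (h n).mk _ p.2 :=
    ae_all_iff.2 fun n => ae_of_ae_map measurable_snd.aemeasurable (h n).ae_eq_mk
  filter_upwards [h1] with p hp
  exact hp p.1

section Optimality

variable {X A I : Type*} [TopologicalSpace X] [PolishSpace X] [MeasurableSpace X] [BorelSpace X]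
  [TopologicalSpace A] [PolishSpace A] [MeasurableSpace A] [BorelSpace A]
  [TopologicalSpace I] [PolishSpace I] [MeasurableSpace I] [BorelSpace I]
  {q : Kernel (X × A) X} [IsMarkovKernel q] {Acts : X → Set A}

theorem Info.optimality [Nonempty X] [Nonempty A] (F : Info X A I) (nr : Prop)
    (hne : ∀ x, (Acts x).Nonempty) (hΓ : AnalyticSet {xa : X × A | xa.2 ∈ Acts xa.1})
    {J : ProbabilityMeasure (Traj X A) → EReal}
    (hJ : LSA fun t => J ⟨param (Traj X A) t, inferInstance⟩) :
    LowerSemianalytic (gOpt q (F.Adapted nr (Acts := Acts)) J) ∧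
      ∀ ε : ℝ, 0 < ε → GoodPolicy q (F.Adapted nr (Acts := Acts)) J ε := by
  classical
  let K := param (Traj X A)
  have hfm : ∀ n, Measurable fun p : Hist X A n × A => (F.stat n p.1, p.2) := fun n =>
    ((F.measurable_stat n).comp measurable_fst).prodMk measurable_snd
  obtain ⟨κ, hκm, hκ⟩ := exists_common_disintegration
    (fun n => (jointK K n).map fun p => (F.stat n p.1, p.2))
    (fun n => Kernel.IsMarkovKernel.map _ (hfm n))
  have hfst : ∀ n t, (((jointK K n).map fun p => (F.stat n p.1, p.2)) t).fst =
      (histK K n t).map (F.stat n) := by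
    intro n t
    rw [Kernel.map_apply _ (hfm n), jointK_apply, histK_apply, Measure.fst,
      Measure.map_map measurable_fst (hfm n),
      Measure.map_map (measurable_fst.comp (hfm n)) (measurable_histOf_action n),
      Measure.map_map (F.measurable_stat n) (measurable_histOf n)]
    rfl
  simp_rw [hfst] at hκ
  have hκ' : ∀ (t : ℚ → ℝ) (m : I → Measure A), UM m → (∀ i, IsProbabilityMeasure (m i)) →
      (∀ n, (jointK K n t).map (fun p => (F.stat n p.1, p.2)) =
        adjoin ((histK K n t).map (F.stat n)) m) →
      ∀ n, ∀ᵐ i ∂(histK K n t).map (F.stat n), κ (t, i) = m i := by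
    intro t m hm hp h
    refine hκ t m hm hp fun n => ?_
    rw [Kernel.map_apply _ (hfm n), h n]
  obtain ⟨sel, hsel, hsel'⟩ := hΓ.exists_um_selector
  replace hsel' : ∀ x, sel x ∈ Acts x := fun x => (hne x).elim fun a ha => hsel' x a ha
  set D := F.feasible nr q Acts K κ with hDdef
  have hD : AnalyticSet D := F.analyticSet_feasible nr hΓ κ
  have hmem : ∀ (π : Policy Acts) (x : X) (p : ProbabilityMeasure (Traj X A)), F.Adapted nr π →
      Induces q π (Measure.dirac x) p.toMeasure →
      ∃ t, (x, t) ∈ D ∧ (⟨K t, inferInstance⟩ : ProbabilityMeasure (Traj X A)) = p := by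
    intro π x p hπ hp
    obtain ⟨t, ht⟩ := exists_param_eq p.toMeasure
    refine ⟨t, F.mem_feasible hκ' hπ ?_, Subtype.ext ht⟩
    change Induces q π (Measure.dirac x) (param (Traj X A) t)
    rwa [ht]
  have hDne : ∀ x, ∃ t, (x, t) ∈ D := by
    intro x
    have hselm : UM fun i => Measure.dirac (sel (F.last i)) :=
      Measure.measurable_dirac.comp_um (hsel.comp_measurable F.measurable_last)
    let π₀ : Policy Acts :=
      { μ := fun n h => Measure.dirac (sel (F.last (F.stat n h)))
        isProb := fun n h => inferInstance
        umeas := fun n B hB => ((hselm.comp_measurable (F.measurable_stat n)).measure_apply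
          hB).universallyMeasurable
        feasible := fun n h => by
          rw [F.last_stat]
          exact Measure.dirac_apply_of_mem (hsel' _) }
    have hπ₀ : F.Adapted nr π₀ := ⟨⟨_, fun i => inferInstance, hselm, fun n h => rfl⟩,
      fun _ n h => ⟨_, rfl⟩⟩
    obtain ⟨P, hP, hPI⟩ := π₀.exists_induces (q := q) (Measure.dirac x)
    obtain ⟨t, ht, -⟩ := hmem π₀ x ⟨P, hP⟩ hπ₀ hPI
    exact ⟨t, ht⟩
  obtain ⟨τ₀, hτ₀, hτ₀'⟩ := hD.exists_um_selector
  replace hτ₀' : ∀ x, (x, τ₀ x) ∈ D := fun x => (hDne x).elim fun t ht => hτ₀' x t ht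
  have hg : gOpt q (F.Adapted nr (Acts := Acts)) J =
      fun x => ⨅ (t : ℚ → ℝ) (_ : (x, t) ∈ D), J ⟨K t, inferInstance⟩ := by
    funext x
    refine le_antisymm (le_iInf₂ fun t ht => ?_) ?_
    · have hτ : UM fun y => if y ∈ ({x} : Set X) then t else τ₀ y :=
        UM.ite (fun μ _ => (measurableSet_singleton x).nullMeasurableSet)
          (.of_measurable measurable_const) hτ₀
      obtain ⟨π, hπ, hI⟩ := F.exists_policy (nr := nr) hΓ hsel hsel' hτ (K := K) (κ := κ) (q := q) (by
        intro y
        split_ifs with h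
        · rw [Set.mem_singleton_iff.1 h]
          exact ht
        · exact hτ₀' y)
      have h1 := hI x
      rw [if_pos (Set.mem_singleton x)] at h1
      exact iInf₂_le_of_le π hπ (iInf₂_le_of_le ⟨K t, inferInstance⟩ h1 le_rfl)
    · refine le_iInf₂ fun π hπ => le_iInf₂ fun p hp => ?_
      obtain ⟨t, ht, rfl⟩ := hmem π x p hπ hp
      exact iInf₂_le t ht
  refine ⟨hg ▸ (lsa_partialInf hD hJ).lowerSemianalytic, fun ε hε => ?_⟩
  obtain ⟨φ, hφ, hφD, hφε, hφopt⟩ := exists_um_epsilonOptimal_selector hD hDne hJ hg hε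
  obtain ⟨π, hπ, hI⟩ := F.exists_policy hΓ hsel hsel' hφ hφD
  refine ⟨π, fun x => ⟨K (φ x), inferInstance⟩, hπ, hI, hφε, ?_⟩
  rintro x ⟨π', p, hπ', hp, hpJ⟩
  obtain ⟨t, ht, rfl⟩ := hmem π' x p hπ' hp
  exact hφopt x ⟨t, ht, hpJ⟩

theorem Info.optimality_of_iff [Nonempty X] [Nonempty A] (F : Info X A I) (nr : Prop)
    (hne : ∀ x, (Acts x).Nonempty) (hΓ : AnalyticSet {xa : X × A | xa.2 ∈ Acts xa.1})
    {J : ProbabilityMeasure (Traj X A) → EReal}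
    (hJ : LSA fun t => J ⟨param (Traj X A) t, inferInstance⟩)
    {C : Policy Acts → Prop} (hC : ∀ π, C π ↔ F.Adapted nr π) :
    LowerSemianalytic (gOpt q C J) ∧ ∀ ε : ℝ, 0 < ε → GoodPolicy q C J ε := by
  rw [funext fun π => propext (hC π)]
  exact F.optimality nr hne hΓ hJ

/-- The full history as information. -/
def Info.full (X A : Type*) [MeasurableSpace X] [MeasurableSpace A] [Nonempty X] [Nonempty A] :
    Info X A (ℕ × Traj X A × X) where
  stat n h := (n, fun k => if hk : k < n then h.1 ⟨k, hk⟩ else Classical.arbitrary _, h.2)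
  measurable_stat n := by
    refine measurable_const.prodMk ((measurable_pi_lambda _ fun k => ?_).prodMk measurable_snd)
    split_ifs
    · exact (measurable_pi_apply _).comp measurable_fst
    · exact measurable_const
  first i := if i.1 = 0 then i.2.2 else (i.2.1 0).1
  measurable_first := Measurable.ite (measurable_fst (measurableSet_singleton 0))
    measurable_snd.snd ((measurable_pi_apply 0).comp measurable_snd.fst).fst
  first_stat n h := by cases n <;> simp [firstState]
  last i := i.2.2
  measurable_last := measurable_snd.snd
  last_stat _ _ := rfl

/-- Time, the initial state and the current state as information. -/
def Info.semiMarkov (X A : Type*) [TopologicalSpace X] [PolishSpace X] [MeasurableSpace X]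
    [BorelSpace X] [TopologicalSpace A] [PolishSpace A] [MeasurableSpace A] [BorelSpace A] : Info X A (ℕ × X × X) where
  stat n h := (n, firstState h, h.2)
  measurable_stat _ := measurable_const.prodMk ((measurable_firstState _).prodMk measurable_snd)
  first i := i.2.1
  measurable_first := measurable_snd.fst
  first_stat _ _ := rfl
  last i := i.2.2
  measurable_last := measurable_snd.snd
  last_stat _ _ := rfl

/-- The initial state and the current state as information. -/
def Info.semiStationary (X A : Type*) [TopologicalSpace X] [PolishSpace X] [MeasurableSpace X]
    [BorelSpace X] [TopologicalSpace A] [PolishSpace A] [MeasurableSpace A] [BorelSpace A] : Info X A (X × X) where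
  stat _ h := (firstState h, h.2)
  measurable_stat _ := (measurable_firstState _).prodMk measurable_snd
  first i := i.1
  measurable_first := measurable_fst
  first_stat _ _ := rfl
  last i := i.2
  measurable_last := measurable_snd
  last_stat _ _ := rfl

theorem Info.adapted_full_iff [Nonempty X] [Nonempty A] {nr : Prop} {π : Policy Acts} :
    (Info.full X A).Adapted nr π ↔ (nr → π.Nonrandomized) := by
  refine ⟨And.right, fun h => ⟨⟨fun i => π.μ i.1 (fun k => i.2.1 k, i.2.2), fun i => π.isProb _ _,
    UM.of_forall_nat fun n => (π.um n).comp_measurable (Measurable.prodMk ?_ measurable_snd), fun n h => ?_⟩, h⟩⟩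
  · exact measurable_pi_lambda _ fun k => (measurable_pi_apply _).comp measurable_fst
  · simp [Info.full]

theorem Info.adapted_semiMarkov_iff [Nonempty A] {nr : Prop} {π : Policy Acts} :
    (Info.semiMarkov X A).Adapted nr π ↔ π.SemiMarkov ∧ (nr → π.Nonrandomized) := by
  refine and_congr_left fun _ => ⟨?_, ?_⟩
  · rintro ⟨m, -, -, h⟩
    exact ⟨fun n z => m (n, z), h⟩
  · rintro ⟨m, hm⟩
    have a₀ : A := Classical.arbitrary A
    refine ⟨fun i => π.μ i.1 (fun _ => (i.2.1, a₀), i.2.2), fun i => π.isProb _ _,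
      UM.of_forall_nat fun n => (π.um n).comp_measurable (Measurable.prodMk
        (measurable_pi_lambda _ fun _ => measurable_fst.prodMk measurable_const) measurable_snd),
      fun n h => ?_⟩
    cases n with
    | zero => exact congrArg (π.μ 0) (Prod.ext (Subsingleton.elim (α := Fin 0 → X × A) _ _) rfl :
        h = ((fun _ => (h.2, a₀), h.2) : Hist X A 0))
    | succ n => exact (hm _ _).trans (hm (n + 1) (fun _ => (firstState h, a₀), h.2)).symm

theorem Info.adapted_semiStationary_iff [Nonempty A] {nr : Prop} {π : Policy Acts} :
    (Info.semiStationary X A).Adapted nr π ↔ π.SemiStationary ∧ (nr → π.Nonrandomized) := by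
  refine and_congr_left fun _ => ⟨?_, ?_⟩
  · rintro ⟨m, -, -, h⟩
    exact ⟨m, h⟩
  · rintro ⟨m, hm⟩
    have a₀ : A := Classical.arbitrary A
    exact ⟨fun i => π.μ 1 (fun _ => (i.1, a₀), i.2), fun i => π.isProb _ _,
      (π.um 1).comp_measurable (by fun_prop),
      fun n h => (hm _ _).trans (hm 1 (fun _ => (firstState h, a₀), h.2)).symm⟩

theorem optimality_of_isEmpty [IsEmpty X] {C : Policy Acts → Prop}
    (hC : ∀ π, C π) (J : ProbabilityMeasure (Traj X A) → EReal) :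
    LowerSemianalytic (gOpt q C J) ∧ ∀ ε : ℝ, 0 < ε → GoodPolicy q C J ε := by
  refine ⟨fun r => ?_, fun ε _ => ?_⟩
  · rw [Set.eq_empty_of_isEmpty {x | gOpt q C J x ≤ r}]
    exact analyticSet_empty
  · exact ⟨⟨fun _ h => isEmptyElim h.2, fun _ h => isEmptyElim h.2,
      fun _ _ _ _ _ μ _ => by rw [Set.eq_empty_of_isEmpty (_ ⁻¹' _)]; exact .empty,
      fun _ h => isEmptyElim h.2⟩, isEmptyElim, hC _, isEmptyElim, isEmptyElim, isEmptyElim⟩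

end Optimality

end PaperStmt

namespace PaperStmt

variable {X A : Type*} [TopologicalSpace X] [PolishSpace X] [MeasurableSpace X] [BorelSpace X]
  [TopologicalSpace A] [PolishSpace A] [MeasurableSpace A] [BorelSpace A]

/-- Theorem `thm-risk-mdp-opt`: for a real-valued (on `Γ`) lower
semianalytic cost and any of the risk criteria `J_ψ`, `Ĵ_ψ`, `CVaR`, `VaR`, the optimal
risk function is lower semianalytic, and for each `ε > 0` and each policy class
`Π_⋆ ∈ {Π, Π', Π_sm, Π'_sm, Π_ss, Π'_ss}` there is an `ε`-optimal policy in `Π_⋆` that is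
optimal at every state admitting an optimal policy. -/
theorem statement12
    (q : Kernel (X × A) X) [IsMarkovKernel q] (Acts : X → Set A)
    (hne : ∀ x, (Acts x).Nonempty)
    (hΓ : MeasureTheory.AnalyticSet {xa : X × A | xa.2 ∈ Acts xa.1})
    (c : X × A → EReal) (hc : LowerSemianalytic c)
    (hreal : ∀ xa : X × A, xa.2 ∈ Acts xa.1 → c xa ≠ ⊤ ∧ c xa ≠ ⊥)
    (hext : ∀ xa : X × A, xa.2 ∉ Acts xa.1 → c xa = ⊤)
    (J : ProbabilityMeasure (Traj X A) → EReal)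
    (hJ : (∃ (ψ : EReal → ℝ≥0∞) (ψinv : ℝ≥0∞ → EReal), StrictMono ψ ∧ Continuous ψ ∧
            Monotone ψinv ∧ (∀ y : EReal, ψinv (ψ y) = y) ∧ J = Jpsi c ψ ψinv) ∨
          (∃ (ψ : EReal → ℝ≥0∞) (ψinv : ℝ≥0∞ → EReal), StrictMono ψ ∧ Continuous ψ ∧
            Monotone ψinv ∧ (∀ y : EReal, ψinv (ψ y) = y) ∧ J = JpsiHat c ψ ψinv) ∨
          (∃ α : ℝ, 0 < α ∧ α ≤ 1 ∧ J = Rcvar c α) ∨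
          (∃ α : ℝ, 0 < α ∧ α ≤ 1 ∧ J = Rvar c α)) :
    ∀ C : Policy Acts → Prop,
      ((C = fun _ => True) ∨ C = Policy.Nonrandomized ∨
       C = Policy.SemiMarkov ∨ (C = fun π => π.SemiMarkov ∧ π.Nonrandomized) ∨
       C = Policy.SemiStationary ∨ (C = fun π => π.SemiStationary ∧ π.Nonrandomized)) →
      LowerSemianalytic (gOpt q C J) ∧
      ∀ ε : ℝ, 0 < ε → GoodPolicy q C J ε := by
  intro C hC
  rcases isEmpty_or_nonempty X with hX | hX
  · refine optimality_of_isEmpty (fun π => ?_) J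
    have hn : π.Nonrandomized := fun n h => isEmptyElim h.2
    have hsm : π.SemiMarkov := ⟨fun _ z => isEmptyElim z, fun n h => isEmptyElim h.2⟩
    have hss : π.SemiStationary := ⟨isEmptyElim, fun n h => isEmptyElim h.2⟩
    rcases hC with rfl | rfl | rfl | rfl | rfl | rfl
    exacts [trivial, hn, hsm, ⟨hsm, hn⟩, hss, ⟨hss, hn⟩]
  have hA : Nonempty A := (hne (Classical.arbitrary X)).to_type
  have hbot : ∀ xa, c xa ≠ ⊥ := by
    intro xa
    by_cases h : xa.2 ∈ Acts xa.1
    · exact (hreal xa h).2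
    · simp [hext xa h]
  have hJ' : LSA fun t => J ⟨param (Traj X A) t, inferInstance⟩ := by
    rcases hJ with ⟨ψ, ψinv, hψ, hψc, -, hinv, rfl⟩ | ⟨ψ, ψinv, hψ, hψc, -, hinv, rfl⟩ |
      ⟨α, hα, -, rfl⟩ | ⟨α, -, -, rfl⟩
    · exact lsa_Jpsi hc.lsa hbot hψ hψc hinv _
    · exact lsa_JpsiHat hc.lsa hbot hψ hψc hinv _
    · exact lsa_Rcvar hc.lsa hbot hα _
    · exact lsa_Rvar hc.lsa hbot α _
  rcases hC with rfl | rfl | rfl | rfl | rfl | rfl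
  · exact (Info.full X A).optimality_of_iff False hne hΓ hJ' fun π => by simp [Info.adapted_full_iff]
  · exact (Info.full X A).optimality_of_iff True hne hΓ hJ' fun π => by simp [Info.adapted_full_iff]
  · exact (Info.semiMarkov X A).optimality_of_iff False hne hΓ hJ' fun π => by simp [Info.adapted_semiMarkov_iff]
  · exact (Info.semiMarkov X A).optimality_of_iff True hne hΓ hJ' fun π => by simp [Info.adapted_semiMarkov_iff]
  · exact (Info.semiStationary X A).optimality_of_iff False hne hΓ hJ' fun π => by simp [Info.adapted_semiStationary_iff]
  · exact (Info.semiStationary X A).optimality_of_iff True hne hΓ hJ' fun π => by simp [Info.adapted_semiStationary_iff]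

end PaperStmt
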